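/- arXiv:2511.21372 — 3 statements merged into one kernel-verified Lean document; each statement's English description precedes it below -/
import Mathlib

section
/- Let $n \geq 3$ and let $\sigma$ be a real number with $0 < \sigma < n-2$. Then there exists a constant $C > 0$ (depending only on $n$ and $\sigma$) such that for every $y \in \mathbb{R}^n$, $\int_{\mathbb{R}^n} |y-x|^{-(n-2)} (1+|x|)^{-(2+\sigma)} \, dx \leq C (1+|y|)^{-\sigma}$. -/
open MeasureTheory

section RadialPowers

open Set Metric Module

variable {E : Type*} [NormedAddCommGroup E] [NormedSpace ℝ E] [FiniteDimensional ℝ E]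
  [Nontrivial E] [MeasurableSpace E] [BorelSpace E] (μ : Measure E) [μ.IsAddHaarMeasure]

lemma eqOn_pow_mul_indicator_rpow {S : Set ℝ} (hS : S ⊆ Ioi 0) {d : ℕ} (hd : 1 ≤ d) (a : ℝ) :
    (fun t : ℝ ↦ t ^ (d - 1) • S.indicator (fun t ↦ t ^ (-a)) t) =
      S.indicator fun t ↦ t ^ ((d : ℝ) - 1 - a) := by
  ext t
  by_cases ht : t ∈ S
  · have h0 : 0 < t := hS ht
    simp only [ht, indicator_of_mem, smul_eq_mul]
    rw [← Real.rpow_natCast, ← Real.rpow_add h0, Nat.cast_sub hd]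
    congr 1
    push_cast
    ring
  · simp [ht]

lemma integrable_indicator_norm_rpow {S : Set ℝ} (hS : S ⊆ Ioi 0) (hm : MeasurableSet S) {a : ℝ}
    (h : IntegrableOn (fun t : ℝ ↦ t ^ ((finrank ℝ E : ℝ) - 1 - a)) S) :
    Integrable (fun x : E ↦ S.indicator (fun t ↦ t ^ (-a)) ‖x‖) μ := by
  rw [integrable_fun_norm_addHaar μ, eqOn_pow_mul_indicator_rpow hS finrank_pos]
  exact (h.integrable_indicator hm).integrableOn

lemma integral_indicator_norm_rpow {S : Set ℝ} (hS : S ⊆ Ioi 0) (hm : MeasurableSet S) (a : ℝ) :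
    ∫ x : E, S.indicator (fun t ↦ t ^ (-a)) ‖x‖ ∂μ =
      finrank ℝ E * μ.real (ball 0 1) * ∫ t in S, t ^ ((finrank ℝ E : ℝ) - 1 - a) := by
  rw [integral_fun_norm_addHaar μ, eqOn_pow_mul_indicator_rpow hS finrank_pos,
    setIntegral_indicator hm, inter_eq_self_of_subset_right hS, nsmul_eq_mul, smul_eq_mul,
    mul_assoc]

lemma integrableOn_Ioc_rpow {b ρ : ℝ} (hb : -1 < b) (hρ : 0 ≤ ρ) :
    IntegrableOn (fun t : ℝ ↦ t ^ b) (Ioc 0 ρ) := by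
  rw [← intervalIntegrable_iff_integrableOn_Ioc_of_le hρ]
  exact intervalIntegral.intervalIntegrable_rpow' hb

lemma setIntegral_Ioc_rpow {b ρ : ℝ} (hb : -1 < b) (hρ : 0 ≤ ρ) :
    ∫ t in Ioc 0 ρ, t ^ b = ρ ^ (b + 1) / (b + 1) := by
  rw [← intervalIntegral.integral_of_le hρ, integral_rpow (Or.inl hb),
    Real.zero_rpow (by linarith), sub_zero]

end RadialPowers

section Pointwise

open Set

variable {E : Type*} [NormedAddCommGroup E]

/-- The three terms control the region near `y`, the region of size comparable to `1 + ‖y‖` away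
from `y`, and the region near infinity. -/
lemma riesz_mul_bracket_le {m s : ℝ} (hm : 0 ≤ m) (hs : 0 ≤ s) {x y : E} (hx : x ≠ 0)
    (hxy : x ≠ y) :
    ‖y - x‖ ^ (-m) * (1 + ‖x‖) ^ (-s) ≤
      ((1 + ‖y‖) / 2) ^ (-s) * (Ioc 0 ((1 + ‖y‖) / 2)).indicator (fun t ↦ t ^ (-m)) ‖y - x‖
      + ((1 + ‖y‖) / 2) ^ (-m) * (Ioc 0 (2 * (1 + ‖y‖))).indicator (fun t ↦ t ^ (-s)) ‖x‖
      + (1 / 2) ^ (-m) * (Ioi (2 * (1 + ‖y‖))).indicator (fun t ↦ t ^ (-(m + s))) ‖x‖ := by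
  have hx0 : 0 < ‖x‖ := norm_pos_iff.2 hx
  have hd0 : 0 < ‖y - x‖ := norm_pos_iff.2 (sub_ne_zero.2 hxy.symm)
  have hy0 : 0 ≤ ‖y‖ := norm_nonneg y
  have tri₁ : ‖y‖ ≤ ‖y - x‖ + ‖x‖ := by simpa using norm_add_le (y - x) x
  have tri₂ : ‖x‖ - ‖y‖ ≤ ‖y - x‖ := by rw [norm_sub_rev y x]; exact norm_sub_norm_le x y
  have nonneg (S : Set ℝ) (a t : ℝ) (ht : 0 ≤ t) : 0 ≤ S.indicator (fun t ↦ t ^ (-a)) t :=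
    indicator_apply_nonneg fun _ ↦ Real.rpow_nonneg ht _
  have h₁ := nonneg (Ioc 0 ((1 + ‖y‖) / 2)) m _ hd0.le
  have h₂ := nonneg (Ioc 0 (2 * (1 + ‖y‖))) s _ hx0.le
  have h₃ := nonneg (Ioi (2 * (1 + ‖y‖))) (m + s) _ hx0.le
  have hw : (1 + ‖x‖) ^ (-s) ≤ ‖x‖ ^ (-s) :=
    Real.rpow_le_rpow_of_nonpos hx0 (by linarith) (by linarith)
  by_cases hnear : ‖y - x‖ ≤ (1 + ‖y‖) / 2
  · refine le_add_of_le_of_nonneg (le_add_of_le_of_nonneg ?_ (by positivity)) (by positivity)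
    rw [indicator_of_mem (show ‖y - x‖ ∈ Ioc 0 ((1 + ‖y‖) / 2) from ⟨hd0, hnear⟩), mul_comm]
    gcongr ?_ * _
    exact Real.rpow_le_rpow_of_nonpos (by positivity) (by linarith) (by linarith)
  push Not at hnear
  by_cases hmid : ‖x‖ ≤ 2 * (1 + ‖y‖)
  · refine le_add_of_le_of_nonneg (le_add_of_nonneg_of_le (by positivity) ?_) (by positivity)
    rw [indicator_of_mem (show ‖x‖ ∈ Ioc 0 (2 * (1 + ‖y‖)) from ⟨hx0, hmid⟩)]
    gcongr ?_ * ?_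
    exact Real.rpow_le_rpow_of_nonpos (by positivity) hnear.le (by linarith)
  · push Not at hmid
    refine le_add_of_nonneg_of_le (by positivity) ?_
    rw [indicator_of_mem (show ‖x‖ ∈ Ioi (2 * (1 + ‖y‖)) from hmid), neg_add,
      Real.rpow_add hx0, ← mul_assoc, ← Real.mul_rpow (by norm_num) hx0.le]
    gcongr ?_ * ?_
    exact Real.rpow_le_rpow_of_nonpos (by positivity) (by linarith) (by linarith)

end Pointwise

theorem stmt_0 (n : ℕ) (hn : 3 ≤ n) (σ : ℝ) (hσ0 : 0 < σ) (hσ : σ < (n : ℝ) - 2) :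
    ∃ C > (0 : ℝ), ∀ y : EuclideanSpace ℝ (Fin n),
      ∫ x : EuclideanSpace ℝ (Fin n),
        ‖y - x‖ ^ (-((n : ℝ) - 2)) * (1 + ‖x‖) ^ (-(2 + σ))
        ≤ C * (1 + ‖y‖) ^ (-σ) := by
  have hfin : Module.finrank ℝ (EuclideanSpace ℝ (Fin n)) = n := by simp
  have : Nontrivial (EuclideanSpace ℝ (Fin n)) :=
    Module.nontrivial_of_finrank_pos (R := ℝ) (by omega)
  set m : ℝ := (n : ℝ) - 2 with hm
  have hm0 : 0 < m := by linarith
  set A : ℝ := n * (volume : Measure (EuclideanSpace ℝ (Fin n))).real (Metric.ball 0 1)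
  have hA : 0 < A := mul_pos (by positivity)
    (ENNReal.toReal_pos (Metric.measure_ball_pos _ _ one_pos).ne' measure_ball_lt_top.ne)
  have hmσ : 0 < m - σ := by linarith
  refine ⟨A * ((1 / 2) ^ (-σ) / 2 + (1 / 2) ^ (-m) * (2 ^ (m - σ) / (m - σ))
    + (1 / 2) ^ (-m) * (2 ^ (-σ) / σ)), by positivity, fun y ↦ ?_⟩
  set R : ℝ := 1 + ‖y‖ with hR
  have hR0 : 0 < R := by positivity
  have exp₁ : -1 < (n : ℝ) - 1 - m := by linarith
  have exp₂ : -1 < (n : ℝ) - 1 - (2 + σ) := by linarith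
  have exp₃ : (n : ℝ) - 1 - (m + (2 + σ)) < -1 := by linarith
  have sub_Ioc (ρ : ℝ) : Set.Ioc 0 ρ ⊆ Set.Ioi 0 := fun _ h ↦ h.1
  have sub_Ioi : Set.Ioi (2 * R) ⊆ Set.Ioi 0 := Set.Ioi_subset_Ioi (by positivity)
  have int₁ := (integrable_indicator_norm_rpow (E := EuclideanSpace ℝ (Fin n)) volume
    (sub_Ioc (R / 2)) measurableSet_Ioc (a := m)
    (by rw [hfin]; exact integrableOn_Ioc_rpow exp₁ (by positivity))).comp_sub_left y
  have int₂ := integrable_indicator_norm_rpow (E := EuclideanSpace ℝ (Fin n)) volume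
    (sub_Ioc (2 * R)) measurableSet_Ioc (a := 2 + σ)
    (by rw [hfin]; exact integrableOn_Ioc_rpow exp₂ (by positivity))
  have int₃ := integrable_indicator_norm_rpow (E := EuclideanSpace ℝ (Fin n)) volume
    sub_Ioi measurableSet_Ioi (a := m + (2 + σ))
    (by rw [hfin]; exact integrableOn_Ioi_rpow_of_lt exp₃ (by positivity))
  have hae : ∀ᵐ x : EuclideanSpace ℝ (Fin n), x ≠ 0 ∧ x ≠ y :=
    (Measure.ae_ne volume 0).and (Measure.ae_ne volume y)
  refine (integral_mono_of_nonneg (.of_forall fun x ↦ by positivity)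
    (((int₁.const_mul ((R / 2) ^ (-(2 + σ)))).add (int₂.const_mul ((R / 2) ^ (-m)))).add
      (int₃.const_mul ((1 / 2) ^ (-m))))
    (hae.mono fun x hx ↦ riesz_mul_bracket_le hm0.le (by linarith) hx.1 hx.2)).trans_eq ?_
  rw [integral_add' ((int₁.const_mul _).add (int₂.const_mul _)) (int₃.const_mul _),
    integral_add' (int₁.const_mul _) (int₂.const_mul _), integral_const_mul, integral_const_mul,
    integral_const_mul,
    integral_sub_left_eq_self (fun x ↦ (Set.Ioc 0 (R / 2)).indicator (fun t ↦ t ^ (-m)) ‖x‖),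
    integral_indicator_norm_rpow _ (sub_Ioc _) measurableSet_Ioc,
    integral_indicator_norm_rpow _ (sub_Ioc _) measurableSet_Ioc,
    integral_indicator_norm_rpow _ sub_Ioi measurableSet_Ioi, hfin,
    setIntegral_Ioc_rpow exp₁ (by positivity), setIntegral_Ioc_rpow exp₂ (by positivity),
    integral_Ioi_rpow_of_lt exp₃ (by positivity),
    show (n : ℝ) - 1 - m + 1 = 2 by rw [hm]; ring,
    show (n : ℝ) - 1 - (2 + σ) + 1 = m - σ by rw [hm]; ring,
    show (n : ℝ) - 1 - (m + (2 + σ)) + 1 = -σ by rw [hm]; ring, neg_div_neg_eq]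
  have near : (R / 2) ^ (-(2 + σ)) * (R / 2) ^ (2 : ℝ) = (1 / 2) ^ (-σ) * R ^ (-σ) := by
    rw [← Real.rpow_add (by positivity), ← Real.mul_rpow (by norm_num) hR0.le]
    ring_nf
  have mid : (R / 2) ^ (-m) * (2 * R) ^ (m - σ) = (1 / 2) ^ (-m) * 2 ^ (m - σ) * R ^ (-σ) := by
    rw [show R / 2 = 1 / 2 * R by ring, Real.mul_rpow (by norm_num) hR0.le,
      Real.mul_rpow (by norm_num) hR0.le, show -σ = -m + (m - σ) by ring, Real.rpow_add hR0]
    ring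
  rw [Real.mul_rpow (x := 2) (z := -σ) (by norm_num) hR0.le]
  linear_combination (A / 2) * near + (A / (m - σ)) * mid
end

section
/- Let $\Omega \subset \mathbb{R}^n$ ($n \geq 3$) be a smooth bounded domain, $\epsilon \in (0, p-2)$ with $p = \frac{n+2}{n-2}$, and let $u \in C^3(\Omega)$ be a positive solution of $-\Delta u = (|x|^{-(n-2)} \ast u^{p-\epsilon})\, u^{p-1-\epsilon}$ in $\Omega$ (where the convolution is over $\Omega$). Then for every $z \in \mathbb{R}^n$, the function $v(x) = (x-z)\cdot\nabla u(x) + \frac{2}{p-1-\epsilon}u(x)$ satisfies the linearized equation $-\Delta v = (p-\epsilon)\left(\int_\Omega \frac{u(y)^{p-1-\epsilon}\, v(y)}{|x-y|^{n-2}}\,dy\right) u(x)^{p-1-\epsilon} + (p-1-\epsilon)\left(\int_\Omega \frac{u(y)^{p-\epsilon}}{|x-y|^{n-2}}\,dy\right) u(x)^{p-2-\epsilon}\, v(x)$ in $\Omega$. -/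
open MeasureTheory

/-- The Laplacian of `u : ℝⁿ → ℝ` as the sum of the second partial derivatives. -/
noncomputable def lap (n : ℕ) (u : EuclideanSpace ℝ (Fin n) → ℝ)
    (x : EuclideanSpace ℝ (Fin n)) : ℝ :=
  ∑ i : Fin n,
    fderiv ℝ (fun z => fderiv ℝ u z (EuclideanSpace.single i 1)) x (EuclideanSpace.single i 1)

open Set Filter Topology in
/-- A `C¹` function that is positive on an open set and vanishes on its frontier has, after
extension by zero, differentiable powers of exponent at least two. -/
lemma hasFDerivAt_indicator_rpow {E : Type*} [NormedAddCommGroup E] [NormedSpace ℝ E]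
    {Ω : Set E} (hΩ : IsOpen Ω) {u : E → ℝ} (hu : ContDiffOn ℝ 1 u (closure Ω))
    (hpos : ∀ x ∈ Ω, 0 < u x) (hbd : ∀ x ∈ frontier Ω, u x = 0) {q : ℝ} (hq : 2 ≤ q) (x : E) :
    HasFDerivAt (Ω.indicator fun y => u y ^ q)
      (Ω.indicator (fun y => (q * u y ^ (q - 1)) • fderiv ℝ u y) x) x := by
  by_cases hx : x ∈ Ω
  · have h1 : HasFDerivAt u (fderiv ℝ u x) x :=
      ((hu.contDiffAt (mem_of_superset (hΩ.mem_nhds hx) subset_closure)).differentiableAt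
        one_ne_zero).hasFDerivAt
    rw [indicator_of_mem hx]
    refine (h1.rpow_const (p := q) (Or.inl (hpos x hx).ne')).congr_of_eventuallyEq ?_
    filter_upwards [hΩ.mem_nhds hx] with y hy
    simp [hy]
  rw [indicator_of_notMem hx]
  by_cases hc : x ∈ closure Ω
  · have hux : u x = 0 := hbd x (by rw [hΩ.frontier_eq]; exact ⟨hc, hx⟩)
    have hO : (fun y => u y - u x) =O[𝓝[closure Ω] x] fun y => y - x :=
      (hu.differentiableOn one_ne_zero x hc).isBigO_sub
    have hlim : Tendsto u (𝓝[closure Ω] x) (𝓝 0) := by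
      simpa [ContinuousWithinAt, hux] using hu.continuousOn x hc
    obtain ⟨C, hC⟩ := hO.bound
    refine Asymptotics.IsBigO.hasFDerivAt (n := 2) ?_ one_lt_two
    refine Asymptotics.IsBigO.of_bound (C ^ 2) ?_
    rw [eventually_nhdsWithin_iff] at hC
    filter_upwards [hC,
      eventually_nhdsWithin_iff.1 (hlim.eventually (gt_mem_nhds one_pos))] with y hy hy1
    by_cases hyΩ : y ∈ Ω
    · have h0 := hpos y hyΩ
      have h2 := hy (subset_closure hyΩ)
      have h3 := hy1 (subset_closure hyΩ)
      rw [hux, sub_zero, Real.norm_of_nonneg h0.le] at h2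
      rw [indicator_of_mem hyΩ, Real.norm_of_nonneg (Real.rpow_nonneg h0.le _), norm_pow,
        norm_norm, ← mul_pow]
      calc u y ^ q ≤ u y ^ (2 : ℝ) := Real.rpow_le_rpow_of_exponent_ge h0 h3.le hq
        _ = u y ^ 2 := Real.rpow_two _
        _ ≤ _ := by gcongr
    · rw [indicator_of_notMem hyΩ, norm_zero]
      positivity
  · refine (hasFDerivAt_const (0 : ℝ) x).congr_of_eventuallyEq ?_
    filter_upwards [isClosed_closure.isOpen_compl.mem_nhds hc] with y hy
    exact indicator_of_notMem (fun h => hy (subset_closure h)) _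

open Set Filter Topology in
/-- The derivative of a function that is `C¹` up to the boundary is bounded near each boundary
point. -/
lemma eventually_norm_fderiv_le_of_contDiffOn_closure {E : Type*} [NormedAddCommGroup E]
    [NormedSpace ℝ E] {Ω : Set E} (hΩ : IsOpen Ω) {u : E → ℝ}
    (hu : ContDiffOn ℝ 1 u (closure Ω)) {x : E} (hx : x ∈ closure Ω) :
    ∃ M, ∀ᶠ y in 𝓝 x, y ∈ Ω → ‖fderiv ℝ u y‖ ≤ M := by
  have h := hu x hx
  rw [show (1 : WithTop ℕ∞) = 0 + 1 from (zero_add 1).symm,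
    contDiffWithinAt_succ_iff_hasFDerivWithinAt' (by simp)] at h
  obtain ⟨t, ht, -, -, f', hf', hcont⟩ := h
  rw [insert_eq_of_mem hx] at ht
  refine ⟨‖f' x‖ + 1, ?_⟩
  have h1 : ∀ᶠ y in 𝓝[closure Ω] x, ‖f' y‖ < ‖f' x‖ + 1 :=
    hcont.continuousWithinAt.norm.eventually (gt_mem_nhds (lt_add_one _))
  filter_upwards [eventually_nhdsWithin_iff.1 h1, eventually_nhdsWithin_iff.1 ht] with y hy hyt hyΩ
  have hyc := subset_closure hyΩ
  have := ((hf' y (hyt hyc)).hasFDerivAt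
    (mem_of_superset (hΩ.mem_nhds hyΩ) subset_closure)).fderiv
  rw [this]
  exact (hy hyc).le

open Set Filter Topology in
lemma continuous_indicator_rpow_smul_fderiv {E : Type*} [NormedAddCommGroup E] [NormedSpace ℝ E]
    {Ω : Set E} (hΩ : IsOpen Ω) {u : E → ℝ} (hu : ContDiffOn ℝ 1 u (closure Ω))
    (hpos : ∀ x ∈ Ω, 0 < u x) (hbd : ∀ x ∈ frontier Ω, u x = 0) {q : ℝ} (hq : 1 < q) :
    Continuous (Ω.indicator (fun y => (q * u y ^ (q - 1)) • fderiv ℝ u y)) := by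
  rw [continuous_iff_continuousAt]
  intro x
  by_cases hx : x ∈ Ω
  · have h1 : ContDiffAt ℝ 1 u x :=
      hu.contDiffAt (mem_of_superset (hΩ.mem_nhds hx) subset_closure)
    have h2 : ContinuousAt (fun y => (q * u y ^ (q - 1)) • fderiv ℝ u y) x :=
      (continuousAt_const.mul (h1.continuousAt.rpow_const (Or.inl (hpos x hx).ne'))).smul
        (h1.continuousAt_fderiv one_ne_zero)
    refine h2.congr ?_
    filter_upwards [hΩ.mem_nhds hx] with y hy
    simp [hy]
  by_cases hc : x ∈ closure Ω
  · have hux : u x = 0 := hbd x (by rw [hΩ.frontier_eq]; exact ⟨hc, hx⟩)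
    have hlim : Tendsto u (𝓝[closure Ω] x) (𝓝 0) := by
      simpa [ContinuousWithinAt, hux] using hu.continuousOn x hc
    obtain ⟨M, hM⟩ := eventually_norm_fderiv_le_of_contDiffOn_closure hΩ hu hc
    have hpow : Tendsto (fun y => ‖q * u y ^ (q - 1)‖ * M) (𝓝[closure Ω] x) (𝓝 0) := by
      have := (((hlim.rpow_const (p := q - 1) (Or.inr (by linarith))).const_mul q).norm).mul_const M
      simpa [Real.zero_rpow (by linarith : q - 1 ≠ 0)] using this
    rw [ContinuousAt, indicator_of_notMem hx, Metric.tendsto_nhds]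
    intro δ hδ
    filter_upwards [hM, eventually_nhdsWithin_iff.1 (hpow.eventually (gt_mem_nhds hδ))]
      with y hy hy1
    rw [dist_zero_right]
    by_cases hyΩ : y ∈ Ω
    · rw [indicator_of_mem hyΩ, norm_smul]
      exact (mul_le_mul_of_nonneg_left (hy hyΩ) (norm_nonneg _)).trans_lt
        (hy1 (subset_closure hyΩ))
    · rwa [indicator_of_notMem hyΩ, norm_zero]
  · refine (continuousAt_const (y := (0 : E →L[ℝ] ℝ))).congr ?_
    filter_upwards [isClosed_closure.isOpen_compl.mem_nhds hc] with y hy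
    exact (indicator_of_notMem (fun h => hy (subset_closure h)) _).symm

open Filter Topology in
/-- The Laplacian of the generator of dilations about `z`, shifted by a multiple of `u`. -/
lemma lap_fderiv_sub_add_const_mul {n : ℕ} {u : EuclideanSpace ℝ (Fin n) → ℝ}
    {x : EuclideanSpace ℝ (Fin n)} (hu : ContDiffAt ℝ 3 u x) (z : EuclideanSpace ℝ (Fin n))
    (a : ℝ) :
    DifferentiableAt ℝ (lap n u) x ∧
    lap n (fun y => fderiv ℝ u y (y - z) + a * u y) x =
      fderiv ℝ (lap n u) x (x - z) + (2 + a) * lap n u x := by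
  have hev : ∀ᶠ y in 𝓝 x, ContDiffAt ℝ 3 u y := hu.eventually (by simp)
  have hD1 : ∀ y, ContDiffAt ℝ 3 u y → ContDiffAt ℝ 2 (fderiv ℝ u) y := fun y h =>
    h.fderiv_right (by norm_num)
  have hD2 : ∀ y, ContDiffAt ℝ 3 u y → ContDiffAt ℝ 1 (fderiv ℝ (fderiv ℝ u)) y := fun y h =>
    (hD1 y h).fderiv_right (by norm_num)
  have hd0 : ∀ y, ContDiffAt ℝ 3 u y → HasFDerivAt u (fderiv ℝ u y) y := fun y h =>
    (h.differentiableAt (by norm_num)).hasFDerivAt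
  have hd1 : ∀ y, ContDiffAt ℝ 3 u y →
      HasFDerivAt (fderiv ℝ u) (fderiv ℝ (fderiv ℝ u) y) y := fun y h =>
    ((hD1 y h).differentiableAt (by norm_num)).hasFDerivAt
  have hd2 : HasFDerivAt (fderiv ℝ (fderiv ℝ u)) (fderiv ℝ (fderiv ℝ (fderiv ℝ u)) x) x :=
    ((hD2 x hu).differentiableAt (by norm_num)).hasFDerivAt
  have hsymm2 : ∀ y, ContDiffAt ℝ 3 u y → ∀ v w,
      fderiv ℝ (fderiv ℝ u) y v w = fderiv ℝ (fderiv ℝ u) y w v := fun y h v w =>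
    (h.isSymmSndFDerivAt (by simp; norm_num)) v w
  have hsymm3 : ∀ v w, fderiv ℝ (fderiv ℝ (fderiv ℝ u)) x v w =
      fderiv ℝ (fderiv ℝ (fderiv ℝ u)) x w v := fun v w =>
    ((hD1 x hu).isSymmSndFDerivAt (by simp)) v w
  have happ2 : ∀ v w, HasFDerivAt (fun y => fderiv ℝ (fderiv ℝ u) y v w)
      (((ContinuousLinearMap.apply ℝ ℝ w).comp
        (ContinuousLinearMap.apply ℝ _ v)).comp (fderiv ℝ (fderiv ℝ (fderiv ℝ u)) x)) x :=
    fun v w => ((hd2.clm_apply (hasFDerivAt_const v x)).clm_apply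
      (hasFDerivAt_const w x)).congr_fderiv (by ext; simp)
  have hsymm3' : ∀ h v w, fderiv ℝ (fderiv ℝ (fderiv ℝ u)) x h v w =
      fderiv ℝ (fderiv ℝ (fderiv ℝ u)) x h w v := by
    intro h v w
    have heq : (fun y => fderiv ℝ (fderiv ℝ u) y v w) =ᶠ[𝓝 x]
        fun y => fderiv ℝ (fderiv ℝ u) y w v := by
      filter_upwards [hev] with y hy
      exact hsymm2 y hy v w
    have := heq.fderiv_eq (𝕜 := ℝ)
    rw [(happ2 v w).fderiv, (happ2 w v).fderiv] at this
    simpa using DFunLike.congr_fun this h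
  have hlap : ∀ y, ContDiffAt ℝ 3 u y → lap n u y =
      ∑ i : Fin n, fderiv ℝ (fderiv ℝ u) y (EuclideanSpace.single i 1)
        (EuclideanSpace.single i 1) := by
    intro y hy
    refine Finset.sum_congr rfl fun i _ => ?_
    rw [((hd1 y hy).clm_apply (hasFDerivAt_const _ _)).fderiv]
    simp
  have hlapD : HasFDerivAt (lap n u) (∑ i : Fin n,
      ((ContinuousLinearMap.apply ℝ ℝ (EuclideanSpace.single i 1)).comp
        (ContinuousLinearMap.apply ℝ _ (EuclideanSpace.single i 1))).comp
          (fderiv ℝ (fderiv ℝ (fderiv ℝ u)) x)) x := by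
    refine (HasFDerivAt.fun_sum fun i _ => happ2 (EuclideanSpace.single i 1)
      (EuclideanSpace.single i 1)).congr_of_eventuallyEq ?_
    filter_upwards [hev] with y hy using hlap y hy
  refine ⟨hlapD.differentiableAt, ?_⟩
  rw [hlapD.fderiv, hlap x hu, sum_apply, Finset.mul_sum,
    ← Finset.sum_add_distrib]
  refine Finset.sum_congr rfl fun i _ => ?_
  set e : EuclideanSpace ℝ (Fin n) := EuclideanSpace.single i 1
  have hfirst : (fun y => fderiv ℝ (fun y => fderiv ℝ u y (y - z) + a * u y) y e) =ᶠ[𝓝 x]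
      fun y => fderiv ℝ (fderiv ℝ u) y e (y - z) + (1 + a) * fderiv ℝ u y e := by
    filter_upwards [hev] with y hy
    rw [(((hd1 y hy).clm_apply (hasFDerivAt_sub_const z)).fun_add
      ((hd0 y hy).const_mul a)).fderiv]
    simp
    ring
  rw [hfirst.fderiv_eq, (((hd2.clm_apply (hasFDerivAt_const e x)).clm_apply
    (hasFDerivAt_sub_const z)).fun_add
      (((hd1 x hu).clm_apply (hasFDerivAt_const e x)).const_mul (1 + a))).fderiv]
  simp
  rw [hsymm3' e e x, hsymm3' e e z, hsymm3 e x, hsymm3 e z]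
  ring

/-- A bounded measurable function with bounded support is integrable against a translated Riesz
kernel. -/
lemma integrable_div_norm_sub_rpow {E : Type*} [NormedAddCommGroup E] [NormedSpace ℝ E]
    [FiniteDimensional ℝ E] [MeasurableSpace E] [BorelSpace E] {μ : Measure E}
    [μ.IsAddHaarMeasure] (hd : 1 ≤ Module.finrank ℝ E) {α : ℝ} (hα : α < Module.finrank ℝ E)
    {g : E → ℝ} (hg : Continuous g) (hgc : HasCompactSupport g) (c : E) :
    Integrable (fun y => g y / ‖c - y‖ ^ α) μ := by
  have hloc : LocallyIntegrable (fun w : E => (‖w‖ ^ α)⁻¹) μ := by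
    refine locallyIntegrable_of_norm_le_rpow (C := 1) hd hα (ae_of_all _ fun w => ?_)
      (by fun_prop : Measurable fun w : E => (‖w‖ ^ α)⁻¹).aestronglyMeasurable
    rw [Real.rpow_neg (norm_nonneg _), one_mul, Real.norm_of_nonneg (by positivity)]
  have hint := hloc.integrable_smul_left_of_hasCompactSupport
    (hg.comp (continuous_sub_left c)) (hgc.comp_homeomorph (Homeomorph.subLeft c))
  refine (hint.comp_sub_left c).congr (ae_of_all _ fun y => ?_)
  simp [div_eq_mul_inv]

open Filter Topology Metric in
/-- The derivative of a Riesz potential along the dilation about `z` through `x`. -/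
lemma hasDerivAt_integral_div_norm_sub_rpow {E : Type*} [NormedAddCommGroup E] [NormedSpace ℝ E]
    [FiniteDimensional ℝ E] [MeasurableSpace E] [BorelSpace E] {μ : Measure E}
    [μ.IsAddHaarMeasure] (hd : 1 ≤ Module.finrank ℝ E) {α : ℝ} (hα : α < Module.finrank ℝ E)
    {F : E → ℝ} (hF : ContDiff ℝ 1 F) (hFc : HasCompactSupport F) (x z : E) :
    HasDerivAt (fun s : ℝ => ∫ y, F y / ‖z + s • (x - z) - y‖ ^ α ∂μ)
      ((Module.finrank ℝ E - α) * (∫ y, F y / ‖x - y‖ ^ α ∂μ) +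
        ∫ y, fderiv ℝ F y (y - z) / ‖x - y‖ ^ α ∂μ) 1 := by
  have hscale : ∀ s : ℝ, 0 < s → ∫ y, F y / ‖z + s • (x - z) - y‖ ^ α ∂μ =
      s ^ (Module.finrank ℝ E - α) * ∫ y, F (z + s • (y - z)) / ‖x - y‖ ^ α ∂μ := by
    intro s hs
    have h1 := integral_add_left_eq_self (μ := μ)
      (fun y => F y / ‖z + s • (x - z) - y‖ ^ α) z
    have h2 := Measure.integral_comp_smul μ
      (fun y => F (z + y) / ‖z + s • (x - z) - (z + y)‖ ^ α) s
    have h3 := integral_sub_right_eq_self (μ := μ)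
      (fun y => F (z + s • y) / ‖z + s • (x - z) - (z + s • y)‖ ^ α) z
    have h4 : ∀ y, F (z + s • (y - z)) / ‖z + s • (x - z) - (z + s • (y - z))‖ ^ α =
        s ^ (-α) * (F (z + s • (y - z)) / ‖x - y‖ ^ α) := by
      intro y
      rw [show z + s • (x - z) - (z + s • (y - z)) = s • (x - y) by module, norm_smul,
        Real.norm_of_nonneg hs.le, Real.mul_rpow hs.le (norm_nonneg _), Real.rpow_neg hs.le]
      field_simp
    simp_rw [h4, integral_const_mul] at h3
    rw [← h3, h1, abs_of_pos (by positivity), smul_eq_mul] at h2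
    rw [sub_eq_add_neg (Module.finrank ℝ E : ℝ), Real.rpow_add hs, Real.rpow_natCast, mul_assoc,
      h2]
    field_simp
  have hF' : Continuous (fderiv ℝ F) := hF.continuous_fderiv one_ne_zero
  obtain ⟨C, hC⟩ := hF'.bounded_above_of_compact_support (hFc.fderiv (𝕜 := ℝ))
  have hC0 : 0 ≤ C := (norm_nonneg _).trans (hC x)
  obtain ⟨R, hR0, hR⟩ :=
    (hFc.fderiv (𝕜 := ℝ)).isCompact.isBounded.subset_closedBall_lt 0 z
  have hbound_int : Integrable (fun y => C * (2 * R) * max 0 (2 * R + 1 - dist y z) /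
      ‖x - y‖ ^ α) μ := by
    refine integrable_div_norm_sub_rpow hd hα (by fun_prop)
      (HasCompactSupport.of_support_subset_isCompact (isCompact_closedBall z (2 * R + 1)) ?_) x
    intro y hy
    by_contra hy'
    rw [mem_closedBall, not_le] at hy'
    exact hy (by simp [max_eq_left (sub_nonpos.2 hy'.le)])
  have hcont : ∀ s : ℝ, Continuous fun y => F (z + s • (y - z)) := fun s =>
    hF.continuous.comp (by fun_prop)
  have hmeas : Measurable fun y => ‖x - y‖ ^ α := by fun_prop
  have hderiv := hasDerivAt_integral_of_dominated_loc_of_deriv_le (μ := μ) (x₀ := (1 : ℝ))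
    (s := Set.Ioi (1 / 2)) (F := fun s y => F (z + s • (y - z)) / ‖x - y‖ ^ α)
    (F' := fun s y => fderiv ℝ F (z + s • (y - z)) (y - z) / ‖x - y‖ ^ α)
    (Ioi_mem_nhds (by norm_num))
    (Eventually.of_forall fun s =>
      ((hcont s).measurable.div hmeas).aestronglyMeasurable)
    (by simpa using integrable_div_norm_sub_rpow hd hα hF.continuous hFc x)
    (by
      have : Continuous fun y => fderiv ℝ F (z + (1 : ℝ) • (y - z)) (y - z) :=
        (hF'.comp (by fun_prop)).clm_apply (by fun_prop)
      exact (this.measurable.div hmeas).aestronglyMeasurable)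
    (ae_of_all _ fun y s hs => ?_) hbound_int (ae_of_all _ fun y s _ => ?_)
  · have h1 := (((hasDerivAt_id (1 : ℝ)).rpow_const (p := Module.finrank ℝ E - α)
      (Or.inl one_ne_zero)).mul hderiv.2).congr_of_eventuallyEq
        (f₁ := fun s : ℝ => ∫ y, F y / ‖z + s • (x - z) - y‖ ^ α ∂μ) (by
          filter_upwards [lt_mem_nhds (zero_lt_one (α := ℝ))] with s hs using hscale s hs)
    simpa using h1
  · rw [norm_div, Real.norm_of_nonneg (Real.rpow_nonneg (norm_nonneg (x - y)) α)]
    gcongr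
    by_cases h0 : fderiv ℝ F (z + s • (y - z)) = 0
    · simp only [h0, zero_apply, norm_zero]
      positivity
    have hs' : 1 / 2 < s := hs
    have h1 := hR (subset_tsupport _ h0)
    rw [mem_closedBall, dist_eq_norm, add_sub_cancel_left, norm_smul,
      Real.norm_of_nonneg (by linarith)] at h1
    have h2 : ‖y - z‖ ≤ 2 * R := by nlinarith [norm_nonneg (y - z)]
    calc ‖fderiv ℝ F (z + s • (y - z)) (y - z)‖
        ≤ ‖fderiv ℝ F (z + s • (y - z))‖ * ‖y - z‖ := ContinuousLinearMap.le_opNorm _ _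
      _ ≤ C * (2 * R) := by gcongr; exact hC _
      _ = C * (2 * R) * 1 := (mul_one _).symm
      _ ≤ _ := by
        gcongr
        rw [dist_eq_norm]
        exact le_max_of_le_right (by linarith)
  · have h1 : HasDerivAt (fun s : ℝ => z + s • (y - z)) (y - z) s := by
      simpa using ((hasDerivAt_id s).smul_const (y - z)).const_add z
    exact ((hF.differentiable one_ne_zero _).hasFDerivAt.comp_hasDerivAt s h1).div_const _

theorem stmt_8 (n : ℕ) (hn : 3 ≤ n) (Ω : Set (EuclideanSpace ℝ (Fin n)))
    (hΩopen : IsOpen Ω) (hΩbd : Bornology.IsBounded Ω)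
    (ε : ℝ) (hε : 0 < ε) (hε2 : ε < ((n : ℝ) + 2) / ((n : ℝ) - 2) - 2)
    (u : EuclideanSpace ℝ (Fin n) → ℝ)
    (hreg : ContDiffOn ℝ 3 u (closure Ω))
    (hpos : ∀ x ∈ Ω, 0 < u x)
    (hbd : ∀ x ∈ frontier Ω, u x = 0)
    (heq : ∀ x ∈ Ω, -(lap n u x) =
      (∫ y in Ω, u y ^ (((n : ℝ) + 2) / ((n : ℝ) - 2) - ε) / ‖x - y‖ ^ ((n : ℝ) - 2)) *
        u x ^ (((n : ℝ) + 2) / ((n : ℝ) - 2) - 1 - ε)) :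
    ∀ z : EuclideanSpace ℝ (Fin n),
      ∀ x ∈ Ω,
        -(lap n (fun x' => fderiv ℝ u x' (x' - z) +
            (2 / (((n : ℝ) + 2) / ((n : ℝ) - 2) - 1 - ε)) * u x') x) =
          (((n : ℝ) + 2) / ((n : ℝ) - 2) - ε) *
            (∫ y in Ω, u y ^ (((n : ℝ) + 2) / ((n : ℝ) - 2) - 1 - ε) *
              (fderiv ℝ u y (y - z) +
                (2 / (((n : ℝ) + 2) / ((n : ℝ) - 2) - 1 - ε)) * u y) /
              ‖x - y‖ ^ ((n : ℝ) - 2)) *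
            u x ^ (((n : ℝ) + 2) / ((n : ℝ) - 2) - 1 - ε) +
          (((n : ℝ) + 2) / ((n : ℝ) - 2) - 1 - ε) *
            (∫ y in Ω, u y ^ (((n : ℝ) + 2) / ((n : ℝ) - 2) - ε) / ‖x - y‖ ^ ((n : ℝ) - 2)) *
            u x ^ (((n : ℝ) + 2) / ((n : ℝ) - 2) - 2 - ε) *
            (fderiv ℝ u x (x - z) +
              (2 / (((n : ℝ) + 2) / ((n : ℝ) - 2) - 1 - ε)) * u x) := by
  intro z x hx
  set q : ℝ := ((n : ℝ) + 2) / ((n : ℝ) - 2) - ε with hq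
  rw [show ((n : ℝ) + 2) / ((n : ℝ) - 2) - 1 - ε = q - 1 by rw [hq]; ring] at heq ⊢
  rw [show ((n : ℝ) + 2) / ((n : ℝ) - 2) - 2 - ε = q - 2 by rw [hq]; ring]
  have hq2 : 2 < q := by rw [hq]; linarith
  clear_value q
  have hu1 : ContDiffOn ℝ 1 u (closure Ω) := hreg.of_le (by norm_num)
  have hdim : Module.finrank ℝ (EuclideanSpace ℝ (Fin n)) = n := finrank_euclideanSpace_fin
  have hd : 1 ≤ Module.finrank ℝ (EuclideanSpace ℝ (Fin n)) := by omega
  have hα : (n : ℝ) - 2 < Module.finrank ℝ (EuclideanSpace ℝ (Fin n)) := by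
    rw [hdim]; linarith
  have hF' := hasFDerivAt_indicator_rpow hΩopen hu1 hpos hbd hq2.le
  set F : EuclideanSpace ℝ (Fin n) → ℝ := Ω.indicator fun y => u y ^ q with hFdef
  have hfd : fderiv ℝ F = Ω.indicator fun y => (q * u y ^ (q - 1)) • fderiv ℝ u y :=
    funext fun y => (hF' y).fderiv
  have hF : ContDiff ℝ 1 F := by
    refine contDiff_one_iff_fderiv.2 ⟨fun y => (hF' y).differentiableAt, ?_⟩
    rw [hfd]
    exact continuous_indicator_rpow_smul_fderiv hΩopen hu1 hpos hbd (by linarith)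
  have hFc : HasCompactSupport F :=
    HasCompactSupport.of_support_subset_isCompact hΩbd.isCompact_closure
      (Set.support_indicator_subset.trans subset_closure)
  have hW : ∀ c : EuclideanSpace ℝ (Fin n), ∫ y in Ω, u y ^ q / ‖c - y‖ ^ ((n : ℝ) - 2) =
      ∫ y, F y / ‖c - y‖ ^ ((n : ℝ) - 2) := by
    intro c
    rw [← integral_indicator hΩopen.measurableSet]
    congr with y
    by_cases hy : y ∈ Ω <;> simp [F, hy]
  have hint1 : Integrable fun y => F y / ‖x - y‖ ^ ((n : ℝ) - 2) :=
    integrable_div_norm_sub_rpow hd hα hF.continuous hFc x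
  have hint2 : Integrable fun y => fderiv ℝ F y (y - z) / ‖x - y‖ ^ ((n : ℝ) - 2) := by
    refine integrable_div_norm_sub_rpow hd hα
      ((hF.continuous_fderiv one_ne_zero).clm_apply (by fun_prop))
      ((hFc.fderiv (𝕜 := ℝ)).mono fun y hy h => hy (by simp [h])) x
  have hV : q * ∫ y in Ω, u y ^ (q - 1) * (fderiv ℝ u y (y - z) + 2 / (q - 1) * u y) /
      ‖x - y‖ ^ ((n : ℝ) - 2) = (∫ y, fderiv ℝ F y (y - z) / ‖x - y‖ ^ ((n : ℝ) - 2)) +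
        q * (2 / (q - 1)) * ∫ y, F y / ‖x - y‖ ^ ((n : ℝ) - 2) := by
    rw [← integral_indicator hΩopen.measurableSet, ← integral_const_mul, ← integral_const_mul,
      ← integral_add hint2 (hint1.const_mul _)]
    congr with y
    rw [hfd]
    by_cases hy : y ∈ Ω
    · have : u y ^ q = u y ^ (q - 1) * u y := by
        rw [← Real.rpow_add_one (hpos y hy).ne', sub_add_cancel]
      simp only [F, hy, Set.indicator_of_mem, smul_apply, smul_eq_mul, this]
      ring
    · simp [F, hy]
  have hux : ContDiffAt ℝ 3 u x :=
    hreg.contDiffAt (Filter.mem_of_superset (hΩopen.mem_nhds hx) subset_closure)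
  obtain ⟨hlapd, hlapv⟩ := lap_fderiv_sub_add_const_mul hux z (2 / (q - 1))
  have hline : HasDerivAt (fun s : ℝ => z + s • (x - z)) (x - z) 1 := by
    simpa using ((hasDerivAt_id (1 : ℝ)).smul_const (x - z)).const_add z
  have hx1 : z + (1 : ℝ) • (x - z) = x := by simp
  have hleft : HasDerivAt (fun s : ℝ => -lap n u (z + s • (x - z)))
      (-fderiv ℝ (lap n u) x (x - z)) 1 :=
    (HasFDerivAt.comp_hasDerivAt_of_eq _ hlapd.hasFDerivAt hline hx1.symm).neg
  have hud : HasDerivAt (fun s : ℝ => u (z + s • (x - z))) (fderiv ℝ u x (x - z)) 1 :=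
    HasFDerivAt.comp_hasDerivAt_of_eq _ (hux.differentiableAt (by norm_num)).hasFDerivAt
      hline hx1.symm
  have hright := (hasDerivAt_integral_div_norm_sub_rpow (μ := volume) hd hα hF hFc x z).mul
    (hud.rpow_const (p := q - 1) (Or.inl (by rw [hx1]; exact (hpos x hx).ne')))
  have hev : (fun s : ℝ => -lap n u (z + s • (x - z))) =ᶠ[nhds 1] fun s =>
      (∫ y, F y / ‖z + s • (x - z) - y‖ ^ ((n : ℝ) - 2)) * u (z + s • (x - z)) ^ (q - 1) := by
    have : ∀ᶠ s : ℝ in nhds 1, z + s • (x - z) ∈ Ω :=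
      hline.continuousAt.eventually (hΩopen.mem_nhds (by simpa using hx))
    filter_upwards [this] with s hs
    rw [heq _ hs, hW]
  have hmain := hleft.unique (hright.congr_of_eventuallyEq hev)
  have heqx := heq x hx
  rw [hlapv, hV]
  simp only [hx1, hdim] at hmain
  rw [hW] at heqx ⊢
  rw [neg_add, hmain, ← mul_neg, heqx, show q - 1 - 1 = q - 2 by ring]
  have hpw : u x ^ (q - 1) = u x ^ (q - 2) * u x := by
    rw [← Real.rpow_add_one (hpos x hx).ne']; ring_nf
  have hq1 : q - 1 ≠ 0 := by linarith
  rw [hpw]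
  field_simp
  ring
end

section
/- Let $n \geq 3$, $\alpha \in (0,n)$, and let $\Omega \subset \mathbb{R}^n$ be a smooth bounded star-shaped domain (star-shaped with respect to the origin). Suppose $u \in C^2(\overline{\Omega})$ is a nonnegative solution of $-\Delta u = (|x|^{-\alpha} \ast u^{p_\alpha})\, u^{p_\alpha - 1}$ in $\Omega$ with $u = 0$ on $\partial\Omega$, where $p_\alpha = \frac{2n-\alpha}{n-2}$ and the convolution is taken over $\Omega$. Then $u \equiv 0$. -/
open MeasureTheory

open Filter Topology Set Metric
open scoped NNReal

theorem ContDiffOn.exists_tendsto_fderiv_of_mem_closure {E F : Type*} [NormedAddCommGroup E]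
    [NormedSpace ℝ E] [NormedAddCommGroup F] [NormedSpace ℝ F] {u : E → F} {Ω : Set E}
    (hΩ : IsOpen Ω) (hu : ContDiffOn ℝ 2 u (closure Ω)) {x : E} (hx : x ∈ closure Ω) :
    ∃ L M, HasFDerivWithinAt u L (closure Ω) x ∧ Tendsto (fderiv ℝ u) (𝓝[Ω] x) (𝓝 L) ∧
      Tendsto (fderiv ℝ (fderiv ℝ u)) (𝓝[Ω] x) (𝓝 M) := by
  have h2 : ContDiffWithinAt ℝ (1 + 1) u (closure Ω) x := by
    have := hu x hx; rwa [← one_add_one_eq_two] at this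
  obtain ⟨v, hv, -, -, f', hf', hc'⟩ :=
    (contDiffWithinAt_succ_iff_hasFDerivWithinAt' (by simp)).1 h2
  have h1 : ContDiffWithinAt ℝ (0 + 1) f' (closure Ω) x := by simpa using hc'
  obtain ⟨w, hw, -, -, f'', hf'', hc''⟩ :=
    (contDiffWithinAt_succ_iff_hasFDerivWithinAt' (by simp)).1 h1
  rw [insert_eq_of_mem hx] at hv hw
  have hmono : 𝓝[Ω] x ≤ 𝓝[closure Ω] x := nhdsWithin_mono _ subset_closure
  have hnhds : ∀ y ∈ Ω, closure Ω ∈ 𝓝 y := fun y hy =>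
    mem_of_superset (hΩ.mem_nhds hy) subset_closure
  have e1 : ∀ᶠ y in 𝓝[Ω] x, fderiv ℝ u y = f' y := by
    filter_upwards [hmono hv, self_mem_nhdsWithin] with y hy hyΩ
    exact ((hf' y hy).hasFDerivAt (hnhds y hyΩ)).fderiv
  have e2 : ∀ᶠ y in 𝓝[Ω] x, fderiv ℝ (fderiv ℝ u) y = f'' y := by
    filter_upwards [hmono hw, self_mem_nhdsWithin, eventually_eventually_nhdsWithin.2 e1]
      with y hy hyΩ hyy
    rw [hΩ.nhdsWithin_eq hyΩ] at hyy
    rw [Filter.EventuallyEq.fderiv_eq hyy]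
    exact ((hf'' y hy).hasFDerivAt (hnhds y hyΩ)).fderiv
  refine ⟨f' x, f'' x, hf' x (mem_of_mem_nhdsWithin hx hv), ?_, ?_⟩
  · exact ((hc'.continuousWithinAt.tendsto).mono_left hmono).congr' (e1.mono fun _ h => h.symm)
  · exact ((hc''.continuousWithinAt.tendsto).mono_left hmono).congr' (e2.mono fun _ h => h.symm)

theorem IsCompact.exists_bound_of_tendsto {E F : Type*} [TopologicalSpace E]
    [NormedAddCommGroup F] {f : E → F} {Ω : Set E} (hΩ : IsCompact (closure Ω))
    (hf : ∀ x ∈ closure Ω, ∃ L, Tendsto f (𝓝[Ω] x) (𝓝 L)) :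
    ∃ C, 0 ≤ C ∧ ∀ x ∈ Ω, ‖f x‖ ≤ C := by
  have key : ∃ C, ∀ x ∈ Ω ∩ closure Ω, ‖f x‖ ≤ C := by
    refine hΩ.induction_on (p := fun s => ∃ C, ∀ x ∈ Ω ∩ s, ‖f x‖ ≤ C) ⟨0, by simp⟩ ?_ ?_ ?_
    · rintro s t hst ⟨C, hC⟩
      exact ⟨C, fun x hx => hC x ⟨hx.1, hst hx.2⟩⟩
    · rintro s t ⟨C, hC⟩ ⟨D, hD⟩
      refine ⟨max C D, ?_⟩
      rintro x ⟨hx, h | h⟩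
      · exact (hC x ⟨hx, h⟩).trans (le_max_left _ _)
      · exact (hD x ⟨hx, h⟩).trans (le_max_right _ _)
    · intro x hx
      obtain ⟨L, hL⟩ := hf x hx
      have : ∀ᶠ y in 𝓝[Ω] x, ‖f y‖ ≤ ‖L‖ + 1 :=
        (hL.norm.eventually_lt_const (lt_add_one _)).mono fun _ h => h.le
      rw [eventually_nhdsWithin_iff] at this
      exact ⟨_, mem_nhdsWithin_of_mem_nhds this, ‖L‖ + 1, fun y hy => hy.2 hy.1⟩
  obtain ⟨C, hC⟩ := key
  exact ⟨max C 0, le_max_right _ _,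
    fun x hx => (hC x ⟨hx, subset_closure hx⟩).trans (le_max_left _ _)⟩

theorem IsLocalMin.deriv_deriv_nonneg {g : ℝ → ℝ} {t : ℝ} (h : IsLocalMin g t)
    (hc : ContinuousAt g t) : 0 ≤ deriv (deriv g) t := by
  by_contra! hneg
  have hmax := isLocalMax_of_deriv_deriv_neg hneg h.deriv_eq_zero hc
  have hconst : g =ᶠ[𝓝 t] fun _ => g t := by
    filter_upwards [h, hmax] with s h1 h2 using le_antisymm h2 h1
  have := hconst.deriv.deriv_eq
  simp at this
  exact hneg.ne this

theorem deriv_line {E F : Type*} [NormedAddCommGroup E]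
    [NormedSpace ℝ E] [NormedAddCommGroup F] [NormedSpace ℝ F] {f : E → F} {x v : E} {t : ℝ}
    (hf : DifferentiableAt ℝ f (x + t • v)) :
    HasDerivAt (fun s : ℝ => f (x + s • v)) (fderiv ℝ f (x + t • v) v) t := by
  have : HasDerivAt (fun s : ℝ => x + s • v) v t := by
    simpa using ((hasDerivAt_id t).smul_const v).const_add x
  exact hf.hasFDerivAt.comp_hasDerivAt t this

theorem ContDiffAt.hasDerivAt_deriv_line {E : Type*} [NormedAddCommGroup E]
    [NormedSpace ℝ E] {u : E → ℝ} {x : E} (hu : ContDiffAt ℝ 2 u x) (v : E) :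
    HasDerivAt (deriv fun t : ℝ => u (x + t • v))
      (fderiv ℝ (fun z => fderiv ℝ u z v) x v) 0 := by
  have hev : ∀ᶠ y in 𝓝 x, DifferentiableAt ℝ u y := by
    have := hu.eventually (by simp)
    exact this.mono fun y hy => hy.differentiableAt (by simp)
  have hcont : Tendsto (fun t : ℝ => x + t • v) (𝓝 0) (𝓝 x) := by
    have : Continuous (fun t : ℝ => x + t • v) := by fun_prop
    simpa using this.tendsto 0
  have e : deriv (fun t : ℝ => u (x + t • v)) =ᶠ[𝓝 0]
      fun t => (fun z => fderiv ℝ u z v) (x + t • v) := by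
    filter_upwards [hcont.eventually hev] with t ht using (deriv_line ht).deriv
  have hd : DifferentiableAt ℝ (fun z => fderiv ℝ u z v) x := by
    have h1 : ContDiffAt ℝ 1 (fderiv ℝ u) x := hu.fderiv_right (by norm_num)
    exact (h1.differentiableAt (by simp)).clm_apply (differentiableAt_const _)
  have := deriv_line (f := fun z => fderiv ℝ u z v) (x := x) (v := v) (t := 0) (by simpa using hd)
  simp only [zero_smul, add_zero] at this
  exact this.congr_of_eventuallyEq e

section Hopf

variable {n : ℕ}

theorem norm_add_smul_single_sq (y : EuclideanSpace ℝ (Fin n)) (t : ℝ) (i : Fin n) :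
    ‖y + t • EuclideanSpace.single i (1 : ℝ)‖ ^ 2 = ‖y‖ ^ 2 + 2 * t * y i + t ^ 2 := by
  rw [norm_add_sq_real, inner_smul_right, EuclideanSpace.inner_single_right, norm_smul]
  simp
  ring

theorem hasDerivAt_deriv_exp_line (a b : ℝ) (y : EuclideanSpace ℝ (Fin n)) (i : Fin n) :
    HasDerivAt (deriv fun t : ℝ =>
        Real.exp (a * (b - ‖y + t • EuclideanSpace.single i (1 : ℝ)‖ ^ 2)))
      ((4 * a ^ 2 * y i ^ 2 - 2 * a) * Real.exp (a * (b - ‖y‖ ^ 2))) 0 := by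
  simp only [norm_add_smul_single_sq]
  have hs : ∀ t : ℝ, HasDerivAt (fun t : ℝ => a * (b - (‖y‖ ^ 2 + 2 * t * y i + t ^ 2)))
      (-a * (2 * y i + 2 * t)) t := by
    intro t
    have h1 : HasDerivAt (fun t : ℝ => 2 * t * y i) (2 * y i) t := by
      simpa using ((hasDerivAt_id t).const_mul 2).mul_const (y i)
    have h2 : HasDerivAt (fun t : ℝ => t ^ 2) (2 * t) t := by simpa using hasDerivAt_pow 2 t
    convert! (((h1.const_add (‖y‖ ^ 2)).add h2).const_sub b).const_mul a using 1
    ring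
  have e : (deriv fun t : ℝ => Real.exp (a * (b - (‖y‖ ^ 2 + 2 * t * y i + t ^ 2)))) =
      fun t => Real.exp (a * (b - (‖y‖ ^ 2 + 2 * t * y i + t ^ 2))) * (-a * (2 * y i + 2 * t)) := by
    funext t
    exact (hs t).exp.deriv
  rw [e]
  have h3 : HasDerivAt (fun t : ℝ => -a * (2 * y i + 2 * t)) (-a * 2) 0 := by
    simpa using (((hasDerivAt_id (0 : ℝ)).const_mul 2).const_add (2 * y i)).const_mul (-a)
  convert! (hs 0).exp.mul h3 using 1
  simp
  ring

theorem not_hasFDerivWithinAt_zero_of_lap_nonpos (hn : 0 < n)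
    {Ω : Set (EuclideanSpace ℝ (Fin n))} {u : EuclideanSpace ℝ (Fin n) → ℝ}
    (hcont : ContinuousOn u (closure Ω)) (hC2 : ∀ x ∈ Ω, ContDiffAt ℝ 2 u x)
    (hlap : ∀ x ∈ Ω, lap n u x ≤ 0) (hnonneg : ∀ x ∈ closure Ω, 0 ≤ u x)
    {c z : EuclideanSpace ℝ (Fin n)} {ρ : ℝ} (hρ : 0 < ρ) (hball : ball c ρ ⊆ Ω)
    (hpos : ∀ x ∈ ball c ρ, 0 < u x) (hz : dist z c = ρ) (huz : u z = 0) :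
    ¬ HasFDerivWithinAt u (0 : EuclideanSpace ℝ (Fin n) →L[ℝ] ℝ) (closure Ω) z := by
  intro hderiv
  have hcb : closedBall c ρ ⊆ closure Ω := by
    rw [← closure_ball c hρ.ne']; exact closure_mono hball
  obtain ⟨x₁, hx₁, hmin₁⟩ := (isCompact_closedBall c (ρ / 2)).exists_isMinOn
    ⟨c, mem_closedBall_self (by positivity)⟩
    (hcont.mono ((closedBall_subset_closedBall (by linarith)).trans hcb))
  set m := u x₁ with hm
  have hm0 : 0 < m := hpos x₁ ((closedBall_subset_ball (by linarith)) hx₁)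
  set a : ℝ := 4 * n / ρ ^ 2 with ha
  have hn' : (0 : ℝ) < n := by exact_mod_cast hn
  have ha0 : 0 < a := by positivity
  have haρ : a * ρ ^ 2 = 4 * n := by rw [ha]; field_simp
  set ε : ℝ := m / Real.exp (a * ρ ^ 2) with hε
  have hε0 : 0 < ε := by positivity
  have hεm : ε * Real.exp (a * ρ ^ 2) = m := by rw [hε]; field_simp
  set h : EuclideanSpace ℝ (Fin n) → ℝ := fun x => Real.exp (a * (ρ ^ 2 - ‖x - c‖ ^ 2)) - 1 with hh
  have hhc : Continuous h := by fun_prop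
  set K := closedBall c ρ \ ball c (ρ / 2) with hK
  have hKc : IsCompact K := (isCompact_closedBall c ρ).diff isOpen_ball
  have hKz : z ∈ K := ⟨by simp [hz], by simp [hz]; linarith⟩
  obtain ⟨y, hyK, hymin⟩ := hKc.exists_isMinOn (f := fun x => u x - ε * h x) ⟨z, hKz⟩
    ((hcont.mono (sdiff_subset.trans hcb)).sub (by fun_prop))
  have hy0 : 0 ≤ u y - ε * h y := by
    by_contra! hneg
    have hyd : ‖y - c‖ ≤ ρ := by simpa [dist_eq_norm] using hyK.1
    have hyd' : ρ / 2 ≤ ‖y - c‖ := by simpa [dist_eq_norm] using hyK.2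
    have h1 : ‖y - c‖ ≠ ρ := by
      intro heq
      have : h y = 0 := by simp [hh, heq]
      rw [this] at hneg
      linarith [hnonneg y (hcb hyK.1)]
    have h2 : ‖y - c‖ ≠ ρ / 2 := by
      intro heq
      have h3 : m ≤ u y := hmin₁ (by simp [dist_eq_norm, heq])
      have h4 : h y ≤ Real.exp (a * ρ ^ 2) := by
        have : Real.exp (a * (ρ ^ 2 - ‖y - c‖ ^ 2)) ≤ Real.exp (a * ρ ^ 2) := by
          gcongr; nlinarith [sq_nonneg ‖y - c‖]
        simp only [hh]; linarith
      have h5 : ε * h y ≤ m := by rw [← hεm]; gcongr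
      linarith
    have hyb : y ∈ ball c ρ := by
      simpa [dist_eq_norm] using lt_of_le_of_ne hyd h1
    have hKnhds : K ∈ 𝓝 y := by
      have ho : IsOpen (ball c ρ \ closedBall c (ρ / 2)) := isOpen_ball.sdiff isClosed_closedBall
      refine mem_of_superset (ho.mem_nhds ⟨hyb, ?_⟩)
        (sdiff_subset_sdiff ball_subset_closedBall ball_subset_closedBall)
      simpa [dist_eq_norm] using lt_of_le_of_ne hyd' (Ne.symm h2)
    have hloc : IsLocalMin (fun x => u x - ε * h x) y := hymin.isLocalMin hKnhds
    have huy : ContDiffAt ℝ 2 u y := hC2 y (hball hyb)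
    have hi : ∀ i : Fin n, 0 ≤ fderiv ℝ (fun z => fderiv ℝ u z (EuclideanSpace.single i 1)) y
        (EuclideanSpace.single i 1) -
        ε * ((4 * a ^ 2 * (y - c) i ^ 2 - 2 * a) * Real.exp (a * (ρ ^ 2 - ‖y - c‖ ^ 2))) := by
      intro i
      set e : EuclideanSpace ℝ (Fin n) := EuclideanSpace.single i 1
      have hline : Continuous fun t : ℝ => y + t • e := by fun_prop
      have hline0 : Tendsto (fun t : ℝ => y + t • e) (𝓝 0) (𝓝 y) := by simpa using hline.tendsto 0
      have hmin : IsLocalMin (fun t : ℝ => u (y + t • e) - ε * h (y + t • e)) 0 := by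
        have := hline0.eventually hloc
        simpa [IsLocalMin, IsMinFilter] using this
      have hul : ContDiffAt ℝ 2 (fun t : ℝ => u (y + t • e)) 0 := by
        apply ContDiffAt.comp (0 : ℝ) (g := u) (f := fun t : ℝ => y + t • e) (by simpa using huy)
        fun_prop
      have hexp : (fun t : ℝ => h (y + t • e)) = fun t : ℝ =>
          Real.exp (a * (ρ ^ 2 - ‖(y - c) + t • e‖ ^ 2)) - 1 := by
        funext t
        simp only [hh]
        congr 5
        abel_nf
      have hder : HasDerivAt (deriv fun t : ℝ => u (y + t • e) - ε * h (y + t • e))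
          (fderiv ℝ (fun z => fderiv ℝ u z e) y e - ε *
            ((4 * a ^ 2 * (y - c) i ^ 2 - 2 * a) * Real.exp (a * (ρ ^ 2 - ‖y - c‖ ^ 2)))) 0 := by
        refine ((huy.hasDerivAt_deriv_line e).sub
          ((hasDerivAt_deriv_exp_line a (ρ ^ 2) (y - c) i).const_mul ε)).congr_of_eventuallyEq ?_
        have hd : ∀ᶠ t in 𝓝 (0 : ℝ), DifferentiableAt ℝ (fun t : ℝ => u (y + t • e)) t :=
          (hul.eventually (by simp)).mono fun t ht => ht.differentiableAt (by simp)
        filter_upwards [hd] with t ht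
        have hd2 : Differentiable ℝ (fun t : ℝ =>
            Real.exp (a * (ρ ^ 2 - ‖(y - c) + t • e‖ ^ 2))) := by
          have : Differentiable ℝ (fun t : ℝ => ‖(y - c) + t • e‖ ^ 2) :=
            Differentiable.norm_sq ℝ (by fun_prop)
          fun_prop
        have e1 : (fun t : ℝ => u (y + t • e) - ε * h (y + t • e)) = fun t : ℝ =>
            u (y + t • e) - ε * (Real.exp (a * (ρ ^ 2 - ‖(y - c) + t • e‖ ^ 2)) - 1) := by
          funext s; rw [congrFun hexp s]
        rw [e1, deriv_fun_sub ht (((hd2 t).sub_const 1).const_mul ε),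
          deriv_const_mul _ ((hd2 t).sub_const 1), deriv_sub_const]
        rfl
      have hc : ContinuousAt (fun t : ℝ => u (y + t • e) - ε * h (y + t • e)) 0 :=
        hul.continuousAt.sub ((continuous_const.mul (hhc.comp hline)).continuousAt)
      rw [← hder.deriv]
      exact hmin.deriv_deriv_nonneg hc
    have hsum := Finset.sum_nonneg fun i (_ : i ∈ Finset.univ) => hi i
    rw [Finset.sum_sub_distrib] at hsum
    have hl := hlap y (hball hyb)
    rw [lap] at hl
    have hs2 : ∑ i : Fin n, ε * ((4 * a ^ 2 * (y - c) i ^ 2 - 2 * a) *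
        Real.exp (a * (ρ ^ 2 - ‖y - c‖ ^ 2))) =
        ε * ((4 * a ^ 2 * ‖y - c‖ ^ 2 - 2 * a * n) *
        Real.exp (a * (ρ ^ 2 - ‖y - c‖ ^ 2))) := by
      rw [← Finset.mul_sum, ← Finset.sum_mul, Finset.sum_sub_distrib, ← Finset.mul_sum,
        EuclideanSpace.real_norm_sq_eq]
      simp
      left; ring
    have hpos2 : 0 < 4 * a ^ 2 * ‖y - c‖ ^ 2 - 2 * a * n := by
      have : ρ ^ 2 / 4 ≤ ‖y - c‖ ^ 2 := by nlinarith
      have : a ^ 2 * ρ ^ 2 ≤ 4 * a ^ 2 * ‖y - c‖ ^ 2 := by nlinarith [sq_nonneg a]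
      nlinarith [mul_pos ha0 hn']
    have : 0 < ε * ((4 * a ^ 2 * ‖y - c‖ ^ 2 - 2 * a * n) *
        Real.exp (a * (ρ ^ 2 - ‖y - c‖ ^ 2))) := by positivity
    linarith
  have hzn : ‖z - c‖ = ρ := by rw [← dist_eq_norm, hz]
  have hlow : ∀ t ∈ Ioo (0 : ℝ) (1 / 2), z + t • (c - z) ∈ closedBall c ρ ∧
      ε * (a * ρ ^ 2 * t) ≤ u (z + t • (c - z)) := by
    intro t ht
    have hnorm : ‖z + t • (c - z) - c‖ = (1 - t) * ρ := by
      have : z + t • (c - z) - c = (1 - t) • (z - c) := by module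
      rw [this, norm_smul, hzn, Real.norm_of_nonneg (by linarith [ht.2])]
    have hmem : z + t • (c - z) ∈ K := by
      refine ⟨?_, ?_⟩
      · simp [dist_eq_norm, hnorm]; nlinarith [ht.1]
      · simp [dist_eq_norm, hnorm]; nlinarith [ht.2]
    refine ⟨hmem.1, ?_⟩
    have h1 : u y - ε * h y ≤ u (z + t • (c - z)) - ε * h (z + t • (c - z)) := hymin hmem
    have h2 : a * ρ ^ 2 * t ≤ h (z + t • (c - z)) := by
      simp only [hh, hnorm]
      have := Real.add_one_le_exp (a * (ρ ^ 2 - ((1 - t) * ρ) ^ 2))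
      have h3 : a * ρ ^ 2 * t ≤ a * (ρ ^ 2 - ((1 - t) * ρ) ^ 2) := by
        have : a * (ρ ^ 2 - ((1 - t) * ρ) ^ 2) - a * ρ ^ 2 * t = a * ρ ^ 2 * (t * (1 - t)) := by
          ring
        have h4 : 0 ≤ a * ρ ^ 2 * (t * (1 - t)) := by
          have := ht.1; have : 0 ≤ 1 - t := by linarith [ht.2]
          positivity
        linarith
      linarith
    have h3 : ε * (a * ρ ^ 2 * t) ≤ ε * h (z + t • (c - z)) := by gcongr
    linarith
  have ho := (hasFDerivWithinAt_iff_isLittleO.1 hderiv).bound (show 0 < ε * a * ρ / 2 by positivity)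
  have htend : Tendsto (fun t : ℝ => z + t • (c - z)) (𝓝[>] 0) (𝓝[closure Ω] z) := by
    apply tendsto_nhdsWithin_of_tendsto_nhds_of_eventually_within
    · have : Continuous fun t : ℝ => z + t • (c - z) := by fun_prop
      simpa using (this.tendsto 0).mono_left nhdsWithin_le_nhds
    · filter_upwards [Ioo_mem_nhdsGT (show (0 : ℝ) < 1 / 2 by norm_num)] with t ht
      exact hcb (hlow t ht).1
  obtain ⟨t, ht1, ht2⟩ := ((htend.eventually ho).and
    (Ioo_mem_nhdsGT (show (0 : ℝ) < 1 / 2 by norm_num))).exists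
  have h1 := (hlow t ht2).2
  simp only [huz, zero_apply, sub_zero, add_sub_cancel_left, norm_smul,
    Real.norm_of_nonneg ht2.1.le, norm_sub_rev c z, hzn] at ht1
  have h2 := (le_abs_self _).trans ht1
  have h3 : 0 < ε * a * ρ * (t * ρ) := by have := ht2.1; positivity
  nlinarith

theorem IsPreconnected.forall_pos_of_lap_nonpos (hn : 0 < n)
    {Ω : Set (EuclideanSpace ℝ (Fin n))} {u : EuclideanSpace ℝ (Fin n) → ℝ}
    (hΩ : IsOpen Ω) (hconn : IsPreconnected Ω)
    (hcont : ContinuousOn u (closure Ω)) (hC2 : ∀ x ∈ Ω, ContDiffAt ℝ 2 u x)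
    (hlap : ∀ x ∈ Ω, lap n u x ≤ 0) (hnonneg : ∀ x ∈ closure Ω, 0 ≤ u x)
    {x₀ : EuclideanSpace ℝ (Fin n)} (hx₀ : x₀ ∈ Ω) (hux₀ : 0 < u x₀) : ∀ x ∈ Ω, 0 < u x := by
  set P := Ω ∩ u ⁻¹' Ioi 0 with hP
  have hPo : IsOpen P := (hcont.mono subset_closure).isOpen_inter_preimage hΩ isOpen_Ioi
  suffices Ω ⊆ P from fun x hx => (this hx).2
  refine hconn.subset_of_closure_inter_subset hPo ⟨x₀, hx₀, hx₀, hux₀⟩ ?_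
  rintro w ⟨hwP, hwΩ⟩
  by_contra hwn
  obtain ⟨δ, hδ, hδΩ⟩ := Metric.isOpen_iff.1 hΩ w hwΩ
  obtain ⟨c, hcP, hcw⟩ := Metric.mem_closure_iff.1 hwP (δ / 2) (by positivity)
  obtain ⟨z, hzP, hz⟩ := hPo.isClosed_compl.exists_infDist_eq_dist ⟨w, hwn⟩ c
  have hzw : dist c z ≤ dist w c := by
    rw [← hz, dist_comm]; exact infDist_le_dist_of_mem hwn
  have hzΩ : z ∈ Ω := hδΩ (by
    rw [mem_ball]
    have := dist_triangle z c w
    rw [dist_comm z c, dist_comm c w] at this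
    linarith)
  have hρ : 0 < dist c z := dist_pos.2 fun h => hzP (h ▸ hcP)
  have hballP : ball c (dist c z) ⊆ P := by
    intro y hy
    by_contra hyP
    have := infDist_le_dist_of_mem (x := c) (s := Pᶜ) hyP
    rw [hz, dist_comm c y] at this
    exact absurd (mem_ball.1 hy) (not_lt.2 this)
  have huz : u z = 0 := by
    refine le_antisymm ?_ (hnonneg z (subset_closure hzΩ))
    by_contra! h
    exact hzP ⟨hzΩ, h⟩
  refine not_hasFDerivWithinAt_zero_of_lap_nonpos hn hcont hC2 hlap hnonneg hρ
    (hballP.trans inter_subset_left) (fun x hx => (hballP hx).2) (dist_comm z c) huz ?_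
  have hmin : IsLocalMin u z := by
    filter_upwards [hΩ.mem_nhds hzΩ] with y hy
    rw [huz]; exact hnonneg y (subset_closure hy)
  have := ((hC2 z hzΩ).differentiableAt (by simp)).hasFDerivAt
  rw [hmin.fderiv_eq_zero] at this
  exact this.hasFDerivWithinAt

end Hopf

theorem norm_le_mul_of_notMem {E F : Type*} [NormedAddCommGroup E]
    [NormedSpace ℝ E] [NormedAddCommGroup F] [NormedSpace ℝ F] {Ω : Set E} (hΩ : IsOpen Ω)
    {u : E → F} {M : ℝ} (hcont : ContinuousOn u (closure Ω)) (hbd : ∀ x ∈ frontier Ω, u x = 0)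
    (hd : ∀ x ∈ Ω, DifferentiableAt ℝ u x) (hM : ∀ x ∈ Ω, ‖fderiv ℝ u x‖ ≤ M)
    {x q : E} (hx : x ∈ Ω) (hq : q ∉ Ω) : ‖u x‖ ≤ M * ‖x - q‖ := by
  set γ : ℝ → E := fun t => x + t • (q - x) with hγ
  have hγc : Continuous γ := by fun_prop
  set K : Set ℝ := Icc 0 1 ∩ γ ⁻¹' Ωᶜ with hK
  have hKc : IsCompact K := isCompact_Icc.inter_right (hΩ.isClosed_compl.preimage hγc)
  have hKne : K.Nonempty := ⟨1, by simp [hK, hγ, hq]⟩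
  have hs := hKc.sInf_mem hKne
  set s := sInf K with hsdef
  have hlt : ∀ t ∈ Ico 0 s, γ t ∈ Ω := by
    intro t ht
    by_contra htn
    exact absurd (csInf_le hKc.bddBelow ⟨⟨ht.1, ht.2.le.trans hs.1.2⟩, htn⟩) (not_le.2 ht.2)
  have hs0 : 0 < s := by
    refine lt_of_le_of_ne hs.1.1 fun h => hs.2 ?_
    rw [← h]; simpa [hγ] using hx
  have hcl : ∀ t ∈ Icc 0 s, γ t ∈ closure Ω := by
    intro t ht
    rcases ht.2.lt_or_eq with h | rfl
    · exact subset_closure (hlt t ⟨ht.1, h⟩)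
    · have h1 : closure (Ico 0 s) ⊆ γ ⁻¹' closure Ω := by
        rw [isClosed_closure.preimage hγc |>.closure_subset_iff]
        exact fun t ht => subset_closure (hlt t ht)
      rw [closure_Ico hs0.ne] at h1
      exact h1 ht
  have hfr : u (γ s) = 0 := by
    apply hbd
    rw [hΩ.frontier_eq]
    exact ⟨hcl s ⟨hs0.le, le_rfl⟩, hs.2⟩
  have key := norm_image_sub_le_of_norm_deriv_right_le_segment (f := fun t => u (γ t))
    (f' := fun t => fderiv ℝ u (γ t) (q - x)) (C := M * ‖x - q‖) (a := 0) (b := s)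
    (hcont.comp hγc.continuousOn hcl)
    (fun t ht => (deriv_line (hd _ (hlt t ht))).hasDerivWithinAt)
    (fun t ht => by
      refine (ContinuousLinearMap.le_opNorm _ _).trans ?_
      rw [norm_sub_rev]
      gcongr
      exact hM _ (hlt t ht)) s ⟨hs0.le, le_rfl⟩
  have hM0 : 0 ≤ M := (norm_nonneg _).trans (hM x hx)
  simp only [hfr, zero_sub, norm_neg, sub_zero] at key
  have h0 : γ 0 = x := by simp [hγ]
  rw [h0] at key
  refine key.trans (mul_le_of_le_one_right (by positivity) hs.1.2)

theorem norm_sub_le_of_segment_subset {E F : Type*} [NormedAddCommGroup E]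
    [NormedSpace ℝ E] [NormedAddCommGroup F] [NormedSpace ℝ F] {Ω : Set E}
    {u : E → F} {M : ℝ} (hd : ∀ x ∈ Ω, DifferentiableAt ℝ u x)
    (hM : ∀ x ∈ Ω, ‖fderiv ℝ u x‖ ≤ M) {x y : E} (h : segment ℝ x y ⊆ Ω) :
    ‖u x - u y‖ ≤ M * ‖x - y‖ :=
  (convex_segment x y).norm_image_sub_le_of_norm_hasFDerivWithin_le
    (fun z hz => (hd z (h hz)).hasFDerivAt.hasFDerivWithinAt) (fun z hz => hM z (h hz))
    (right_mem_segment ℝ x y) (left_mem_segment ℝ x y)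

theorem norm_sub_add_norm_sub_of_mem_segment {E : Type*} [NormedAddCommGroup E]
    [NormedSpace ℝ E] {x y q : E} (h : q ∈ segment ℝ x y) :
    ‖x - q‖ + ‖y - q‖ = ‖x - y‖ := by
  have := dist_add_dist_of_mem_segment h
  rwa [dist_eq_norm, dist_eq_norm, dist_eq_norm, norm_sub_rev q y] at this

theorem lipschitzWith_indicator_of_fderiv_le {E F : Type*} [NormedAddCommGroup E]
    [NormedSpace ℝ E] [NormedAddCommGroup F] [NormedSpace ℝ F] {Ω : Set E} (hΩ : IsOpen Ω)
    {u : E → F} {M : ℝ≥0} (hcont : ContinuousOn u (closure Ω)) (hbd : ∀ x ∈ frontier Ω, u x = 0)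
    (hd : ∀ x ∈ Ω, DifferentiableAt ℝ u x) (hM : ∀ x ∈ Ω, ‖fderiv ℝ u x‖ ≤ M) :
    LipschitzWith M (Ω.indicator u) := by
  refine LipschitzWith.of_dist_le_mul fun x y => ?_
  rw [dist_eq_norm, dist_eq_norm]
  by_cases h : segment ℝ x y ⊆ Ω
  · rw [indicator_of_mem (h (left_mem_segment ℝ x y)),
      indicator_of_mem (h (right_mem_segment ℝ x y))]
    exact norm_sub_le_of_segment_subset hd hM h
  · obtain ⟨q, hq, hqΩ⟩ := not_subset.1 h
    have hle : ∀ z, ‖Ω.indicator u z‖ ≤ M * ‖z - q‖ := by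
      intro z
      by_cases hz : z ∈ Ω
      · rw [indicator_of_mem hz]
        exact norm_le_mul_of_notMem hΩ hcont hbd hd hM hz hqΩ
      · rw [indicator_of_notMem hz, norm_zero]; positivity
    rw [← norm_sub_add_norm_sub_of_mem_segment hq, mul_add]
    exact (norm_sub_le _ _).trans (add_le_add (hle x) (hle y))

theorem LipschitzWith.mul_indicator_of_fderiv_le {E : Type*} [NormedAddCommGroup E]
    [NormedSpace ℝ E] {Ω : Set E} {V w : E → ℝ} {L B W M : ℝ≥0} (hV : LipschitzWith L V)
    (hV0 : ∀ x ∉ Ω, V x = 0) (hB : ∀ x, ‖V x‖ ≤ B) (hW : ∀ x ∈ Ω, ‖w x‖ ≤ W)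
    (hd : ∀ x ∈ Ω, DifferentiableAt ℝ w x) (hM : ∀ x ∈ Ω, ‖fderiv ℝ w x‖ ≤ M) :
    LipschitzWith (L * W + B * M) (fun x => V x * Ω.indicator w x) := by
  refine LipschitzWith.of_dist_le_mul fun x y => ?_
  rw [dist_eq_norm, dist_eq_norm]
  push_cast
  have hLip : ∀ a b, ‖V a - V b‖ ≤ L * ‖a - b‖ := fun a b => by
    simpa [dist_eq_norm] using hV.dist_le_mul a b
  by_cases h : segment ℝ x y ⊆ Ω
  · rw [indicator_of_mem (h (left_mem_segment ℝ x y)),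
      indicator_of_mem (h (right_mem_segment ℝ x y))]
    have e : V x * w x - V y * w y = (V x - V y) * w x + V y * (w x - w y) := by ring
    rw [e]
    refine (norm_add_le _ _).trans ?_
    rw [norm_mul, norm_mul, add_mul]
    have h1 : ‖V x - V y‖ * ‖w x‖ ≤ (L * ‖x - y‖) * W :=
      mul_le_mul (hLip x y) (hW x (h (left_mem_segment ℝ x y))) (norm_nonneg _) (by positivity)
    have h2 : ‖V y‖ * ‖w x - w y‖ ≤ B * (M * ‖x - y‖) :=
      mul_le_mul (hB y) (norm_sub_le_of_segment_subset hd hM h) (norm_nonneg _) (by positivity)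
    linarith
  · obtain ⟨q, hq, hqΩ⟩ := not_subset.1 h
    have hle : ∀ z, ‖V z * Ω.indicator w z‖ ≤ L * W * ‖z - q‖ := by
      intro z
      by_cases hz : z ∈ Ω
      · rw [indicator_of_mem hz, norm_mul]
        have h1 := hLip z q
        rw [hV0 q hqΩ, sub_zero] at h1
        calc ‖V z‖ * ‖w z‖ ≤ (L * ‖z - q‖) * W :=
              mul_le_mul h1 (hW z hz) (norm_nonneg _) (by positivity)
          _ = _ := by ring
      · rw [indicator_of_notMem hz, mul_zero, norm_zero]; positivity
    have h3 := (_root_.norm_sub_le _ _).trans (add_le_add (hle x) (hle y))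
    rw [← mul_add, norm_sub_add_norm_sub_of_mem_segment hq] at h3
    refine h3.trans ?_
    gcongr
    exact le_add_of_nonneg_right (by positivity)

theorem integrable_of_bounded_of_eq_zero {X : Type*} [MeasurableSpace X] {μ : Measure X}
    {s : Set X} (hs : μ s ≠ ⊤) {f : X → ℝ} {C : ℝ}
    (hf : AEStronglyMeasurable f μ) (hC : ∀ x ∈ s, ‖f x‖ ≤ C) (h0 : ∀ x ∉ s, f x = 0) :
    Integrable f μ := by
  have hC' : ∀ x, ‖f x‖ ≤ max C 0 := fun x => by
    by_cases hx : x ∈ s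
    · exact (hC x hx).trans (le_max_left _ _)
    · rw [h0 x hx, norm_zero]; exact le_max_right _ _
  rw [← integrableOn_iff_integrable_of_support_subset (s := s)
    (fun x hx => by_contra fun h => hx (h0 x h))]
  exact Measure.integrableOn_of_bounded hs hf (ae_of_all _ hC')

theorem LipschitzWith.integral_lineDeriv_eq_zero {E : Type*} [NormedAddCommGroup E]
    [NormedSpace ℝ E] [FiniteDimensional ℝ E] [MeasurableSpace E] [BorelSpace E] {μ : Measure E}
    [μ.IsAddHaarMeasure] {g : E → ℝ} {L : ℝ≥0} (hg : LipschitzWith L g)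
    (hc : HasCompactSupport g) (v : E) : ∫ x, lineDeriv ℝ g x v ∂μ = 0 := by
  have := LipschitzWith.integral_lineDeriv_mul_eq (μ := μ)
    (LipschitzWith.const (1 : ℝ) : LipschitzWith 0 fun _ : E => (1 : ℝ)) hg hc (-v)
  simpa [lineDeriv] using this.symm

theorem hasFDerivAt_zero_of_abs_le_mul {E : Type*} [NormedAddCommGroup E]
    [NormedSpace ℝ E] {f g : E → ℝ} {x : E} {W : ℝ} (hf : HasFDerivAt f (0 : E →L[ℝ] ℝ) x)
    (hfx : f x = 0) (h : ∀ y, ‖g y‖ ≤ W * ‖f y‖) : HasFDerivAt g (0 : E →L[ℝ] ℝ) x := by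
  have hgx : g x = 0 := by simpa [hfx] using h x
  rw [hasFDerivAt_iff_isLittleO] at hf ⊢
  simp only [hfx, hgx, sub_zero, zero_apply] at hf ⊢
  exact (Asymptotics.IsBigO.of_bound W (Eventually.of_forall h)).trans_isLittleO hf

theorem isLocalMin_of_nonneg_of_eq_zero {X : Type*} [TopologicalSpace X] {f : X → ℝ}
    (hf : ∀ x, 0 ≤ f x) {x : X} (hx : f x = 0) : IsLocalMin f x :=
  Eventually.of_forall fun y => hx ▸ hf y

theorem norm_fderiv_apply_le_of_norm_fderiv_fderiv_le {E : Type*} [NormedAddCommGroup E]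
    [NormedSpace ℝ E] {u : E → ℝ} {x v : E} {M : ℝ} (hu : ContDiffAt ℝ 2 u x)
    (hM : ‖fderiv ℝ (fderiv ℝ u) x‖ ≤ M) :
    DifferentiableAt ℝ (fun z => fderiv ℝ u z v) x ∧
      ‖fderiv ℝ (fun z => fderiv ℝ u z v) x‖ ≤ M * ‖v‖ := by
  have hd : DifferentiableAt ℝ (fderiv ℝ u) x :=
    (hu.fderiv_right (m := 1) (by norm_num)).differentiableAt (by simp)
  refine ⟨hd.clm_apply (differentiableAt_const _), ?_⟩
  have hM0 : 0 ≤ M := le_trans (norm_nonneg (fderiv ℝ (fderiv ℝ u) x)) hM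
  refine ContinuousLinearMap.opNorm_le_bound _ (by positivity) fun y => ?_
  rw [fderiv_clm_apply hd (differentiableAt_const _)]
  simp only [fderiv_fun_const, Pi.zero_apply, ContinuousLinearMap.comp_zero, zero_add,
    ContinuousLinearMap.flip_apply]
  calc ‖fderiv ℝ (fderiv ℝ u) x y v‖ ≤ ‖fderiv ℝ (fderiv ℝ u) x‖ * ‖y‖ * ‖v‖ :=
        ContinuousLinearMap.le_opNorm₂ _ _ _
    _ ≤ M * ‖y‖ * ‖v‖ := by gcongr
    _ = _ := by ring

theorem fderiv_indicator_of_mem {E : Type*} [NormedAddCommGroup E]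
    [NormedSpace ℝ E] {Ω : Set E} (hΩ : IsOpen Ω) (u : E → ℝ) {x : E} (hx : x ∈ Ω) :
    fderiv ℝ (Ω.indicator u) x = fderiv ℝ u x :=
  Filter.EventuallyEq.fderiv_eq <| by
    filter_upwards [hΩ.mem_nhds hx] with y hy using indicator_of_mem hy u

theorem integral_fderiv_indicator_mul_fderiv {E : Type*} [NormedAddCommGroup E]
    [NormedSpace ℝ E] [FiniteDimensional ℝ E] [MeasurableSpace E] [BorelSpace E] {μ : Measure E}
    [μ.IsAddHaarMeasure] {Ω : Set E} (hΩ : IsOpen Ω) (hΩb : Bornology.IsBounded Ω)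
    {u V : E → ℝ} {M M₂ L B : ℝ≥0} (hu : ∀ x ∈ Ω, ContDiffAt ℝ 2 u x)
    (hu0 : ∀ x ∈ Ω, 0 ≤ u x)
    (hM : ∀ x ∈ Ω, ‖fderiv ℝ u x‖ ≤ M) (hM₂ : ∀ x ∈ Ω, ‖fderiv ℝ (fderiv ℝ u) x‖ ≤ M₂)
    (hV : LipschitzWith L V) (hVB : ∀ x, ‖V x‖ ≤ B) (hVnonneg : ∀ x, 0 ≤ V x)
    (hV0 : ∀ x ∉ Ω, V x = 0) (v : E) :
    Integrable (fun x => V x * -fderiv ℝ (fun z => fderiv ℝ u z v) x v) μ ∧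
    ∫ x, fderiv ℝ (Ω.indicator u) x v * fderiv ℝ V x v ∂μ =
      ∫ x, V x * -fderiv ℝ (fun z => fderiv ℝ u z v) x v ∂μ := by
  set w : E → ℝ := fun z => fderiv ℝ u z v with hw
  have hfin : μ Ω ≠ ⊤ := hΩb.measure_lt_top.ne
  have hW : ∀ x ∈ Ω, ‖w x‖ ≤ (M * ‖v‖₊ : ℝ≥0) := fun x hx =>
    (ContinuousLinearMap.le_opNorm _ _).trans (by push_cast; gcongr; exact hM x hx)
  have hwd : ∀ x ∈ Ω, DifferentiableAt ℝ w x ∧ ‖fderiv ℝ w x‖ ≤ (M₂ * ‖v‖₊ : ℝ≥0) := fun x hx => by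
    simpa using norm_fderiv_apply_le_of_norm_fderiv_fderiv_le (v := v) (hu x hx) (hM₂ x hx)
  have hg := hV.mul_indicator_of_fderiv_le hV0 hVB hW (fun x hx => (hwd x hx).1)
    (fun x hx => (hwd x hx).2)
  set g : E → ℝ := fun x => V x * Ω.indicator w x with hgdef
  have hgs : HasCompactSupport g := by
    refine HasCompactSupport.intro hΩb.isCompact_closure fun x hx => ?_
    simp [hgdef, hV0 x fun h => hx (subset_closure h)]
  have hint := hg.integral_lineDeriv_eq_zero (μ := μ) hgs v
  have hU0 : ∀ x, 0 ≤ Ω.indicator u x := fun x => indicator_nonneg hu0 x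
  have hUoff : ∀ x ∉ Ω, fderiv ℝ (Ω.indicator u) x = 0 := fun x hx =>
    (isLocalMin_of_nonneg_of_eq_zero hU0 (indicator_of_notMem hx u)).fderiv_eq_zero
  have hVoff : ∀ x ∉ Ω, fderiv ℝ V x = 0 := fun x hx =>
    (isLocalMin_of_nonneg_of_eq_zero hVnonneg (hV0 x hx)).fderiv_eq_zero
  have hae : (fun x => lineDeriv ℝ g x v) =ᵐ[μ] fun x =>
      fderiv ℝ (Ω.indicator u) x v * fderiv ℝ V x v - V x * -fderiv ℝ w x v := by
    filter_upwards [hV.ae_differentiableAt (μ := μ)] with x hx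
    by_cases hxΩ : x ∈ Ω
    · have hm := (hx.hasFDerivAt.mul (hwd x hxΩ).1.hasFDerivAt)
      have hm' : HasFDerivAt g (V x • fderiv ℝ w x + w x • fderiv ℝ V x) x := by
        refine hm.congr_of_eventuallyEq ?_
        filter_upwards [hΩ.mem_nhds hxΩ] with y hy
        simp [hgdef, hy]
      rw [(hm'.hasLineDerivAt v).lineDeriv, fderiv_indicator_of_mem hΩ u hxΩ]
      simp [hw]
      ring
    · have h0 : HasFDerivAt V (0 : E →L[ℝ] ℝ) x := hVoff x hxΩ ▸ hx.hasFDerivAt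
      have hg0 : HasFDerivAt g (0 : E →L[ℝ] ℝ) x := by
        refine hasFDerivAt_zero_of_abs_le_mul (W := (M * ‖v‖₊ : ℝ≥0)) h0 (hV0 x hxΩ) fun y => ?_
        simp only [hgdef, norm_mul]
        rw [mul_comm]
        gcongr
        by_cases hy : y ∈ Ω
        · rw [indicator_of_mem hy]; exact hW y hy
        · rw [indicator_of_notMem hy, norm_zero]; positivity
      rw [(hg0.hasLineDerivAt v).lineDeriv, hVoff x hxΩ, hV0 x hxΩ]
      simp
  have i1 : Integrable (fun x => fderiv ℝ (Ω.indicator u) x v * fderiv ℝ V x v) μ := by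
    refine integrable_of_bounded_of_eq_zero hfin (C := (M * ‖v‖) * (L * ‖v‖))
      ((measurable_fderiv_apply_const ℝ _ v).mul
        (measurable_fderiv_apply_const ℝ _ v)).aestronglyMeasurable (fun x hx => ?_)
      (fun x hx => by simp [hUoff x hx])
    rw [norm_mul, fderiv_indicator_of_mem hΩ u hx]
    have h1 : ‖fderiv ℝ V x v‖ ≤ L * ‖v‖ :=
      (ContinuousLinearMap.le_opNorm _ _).trans
        (by gcongr; exact norm_fderiv_le_of_lipschitz ℝ hV)
    have h2 : ‖fderiv ℝ u x v‖ ≤ M * ‖v‖ := by simpa using hW x hx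
    gcongr
  have i2 : Integrable (fun x => V x * -fderiv ℝ w x v) μ := by
    refine integrable_of_bounded_of_eq_zero hfin (C := B * ((M₂ * ‖v‖) * ‖v‖))
      (hV.continuous.measurable.mul
        (measurable_fderiv_apply_const ℝ _ v).neg).aestronglyMeasurable (fun x hx => ?_)
      (fun x hx => by simp [hV0 x hx])
    rw [norm_mul, norm_neg]
    have h1 : ‖fderiv ℝ w x v‖ ≤ (M₂ * ‖v‖) * ‖v‖ :=
      (ContinuousLinearMap.le_opNorm _ _).trans (by gcongr; simpa using (hwd x hx).2)
    exact mul_le_mul (hVB x) h1 (norm_nonneg _) (by positivity)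
  refine ⟨i2, ?_⟩
  rw [integral_congr_ae hae, integral_sub i1 i2] at hint
  linarith

/-- The bilinear form `(f, g) ↦ ∬ f(x) g(y) |x - y|^{-α}`. -/
noncomputable def rieszForm {E : Type*} [NormedAddCommGroup E] [MeasureSpace E] (α : ℝ)
    (f g : E → ℝ) : ℝ :=
  ∫ p : E × E, f p.1 * g p.2 * (‖p.1 - p.2‖ ^ α)⁻¹

/-- `f` is measurable, bounded by `C`, and vanishes outside `Ω`. -/
structure IsBddSupportedOn {E : Type*} [MeasurableSpace E] (Ω : Set E) (C : ℝ) (f : E → ℝ) :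
    Prop where
  measurable : Measurable f
  bound : ∀ x, ‖f x‖ ≤ C
  zero : ∀ x ∉ Ω, f x = 0

theorem integrableOn_ball_rpow_norm_inv {E : Type*} [NormedAddCommGroup E] [NormedSpace ℝ E]
    [FiniteDimensional ℝ E] [MeasurableSpace E] [BorelSpace E] (μ : Measure E)
    [μ.IsAddHaarMeasure] [Nontrivial E] {α : ℝ} (hα : α < Module.finrank ℝ E) (r : ℝ) :
    IntegrableOn (fun x : E => (‖x‖ ^ α)⁻¹) (ball 0 r) μ := by
  rw [integrableOn_fun_norm_addHaar μ (f := fun t => (t ^ α)⁻¹)]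
  have h1 : IntegrableOn (fun y : ℝ => y ^ ((Module.finrank ℝ E : ℝ) - 1 - α)) (Ioo 0 r) := by
    rcases le_or_gt r 0 with hr | hr
    · simp [Ioo_eq_empty (not_lt.2 hr)]
    · exact (intervalIntegral.integrableOn_Ioo_rpow_iff hr).2 (by linarith)
  refine h1.congr_fun (fun y hy => ?_) measurableSet_Ioo
  have hy0 : 0 < y := hy.1
  have : ((Module.finrank ℝ E - 1 : ℕ) : ℝ) = (Module.finrank ℝ E : ℝ) - 1 := by
    rw [Nat.cast_sub Module.finrank_pos]; simp
  simp only [smul_eq_mul]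
  rw [Real.rpow_sub hy0, ← this, Real.rpow_natCast, div_eq_mul_inv]

section IsBddSupportedOn

variable {E : Type*} [MeasurableSpace E]

theorem IsBddSupportedOn.sub {Ω : Set E} {C D : ℝ} {f g : E → ℝ} (hf : IsBddSupportedOn Ω C f)
    (hg : IsBddSupportedOn Ω D g) : IsBddSupportedOn Ω (C + D) (fun x => f x - g x) :=
  ⟨hf.measurable.sub hg.measurable,
    fun x => (norm_sub_le _ _).trans (add_le_add (hf.bound x) (hg.bound x)),
    fun x hx => by simp [hf.zero x hx, hg.zero x hx]⟩

theorem IsBddSupportedOn.const_mul {Ω : Set E} {C : ℝ} {f : E → ℝ} (hf : IsBddSupportedOn Ω C f)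
    (c : ℝ) : IsBddSupportedOn Ω (|c| * C) (fun x => c * f x) :=
  ⟨hf.measurable.const_mul c,
    fun x => by rw [norm_mul, Real.norm_eq_abs c]; gcongr; exact hf.bound x,
    fun x hx => by simp [hf.zero x hx]⟩

theorem isBddSupportedOn_indicator_one {Ω : Set E} (hΩ : MeasurableSet Ω) :
    IsBddSupportedOn Ω 1 (Ω.indicator fun _ => (1 : ℝ)) :=
  ⟨measurable_const.indicator hΩ,
    fun x => by by_cases hx : x ∈ Ω <;> simp [hx], fun x hx => by simp [hx]⟩

theorem IsBddSupportedOn.rpow {Ω : Set E} {M : ℝ} {f : E → ℝ} (hf : IsBddSupportedOn Ω M f)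
    (hf0 : ∀ x, 0 ≤ f x) {p : ℝ} (hp : 0 < p) : IsBddSupportedOn Ω (M ^ p) (fun x => f x ^ p) :=
  ⟨hf.measurable.pow_const p, fun x => by
    rw [Real.norm_of_nonneg (Real.rpow_nonneg (hf0 x) p)]
    exact Real.rpow_le_rpow (hf0 x) ((le_abs_self _).trans (hf.bound x)) hp.le,
    fun x hx => by rw [hf.zero x hx, Real.zero_rpow hp.ne']⟩

theorem IsBddSupportedOn.mul {Ω : Set E} {C D : ℝ} {f g : E → ℝ} (hf : IsBddSupportedOn Ω C f)
    (hg : IsBddSupportedOn Ω D g) : IsBddSupportedOn Ω (C * D) (fun x => f x * g x) :=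
  ⟨hf.measurable.mul hg.measurable,
    fun x => by
      rw [norm_mul]
      exact mul_le_mul (hf.bound _) (hg.bound _) (norm_nonneg _)
        ((norm_nonneg _).trans (hf.bound x)),
    fun x hx => by simp [hf.zero x hx]⟩

end IsBddSupportedOn

section Riesz

variable {E : Type*} [NormedAddCommGroup E] [InnerProductSpace ℝ E] [FiniteDimensional ℝ E]
  [MeasurableSpace E] [BorelSpace E]

theorem IsBddSupportedOn.integrable_riesz [Nontrivial E] {α : ℝ}
    (hα : α < Module.finrank ℝ E) {Ω : Set E} (hΩ : MeasurableSet Ω)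
    (hΩb : Bornology.IsBounded Ω) {C D : ℝ} {f g : E → ℝ}
    (hf : IsBddSupportedOn Ω C f) (hg : IsBddSupportedOn Ω D g) :
    Integrable (fun p : E × E => f p.1 * g p.2 * (‖p.1 - p.2‖ ^ α)⁻¹) := by
  obtain ⟨R, hR⟩ := hΩb.subset_ball 0
  have h1 : Integrable (Ω.indicator fun _ : E => (1 : ℝ)) :=
    (integrableOn_const hΩb.measure_lt_top.ne).integrable_indicator hΩ
  have h2 : Integrable ((ball (0 : E) (R + R)).indicator fun x : E => (‖x‖ ^ α)⁻¹) :=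
    (integrableOn_ball_rpow_norm_inv volume hα _).integrable_indicator measurableSet_ball
  have h3 := h1.convolution_integrand (ContinuousLinearMap.mul ℝ ℝ) h2
  have h4 := h3.bdd_mul (c := C * D) (f := fun p : E × E => f p.1 * g p.2)
    ((hf.measurable.comp measurable_fst).mul
      (hg.measurable.comp measurable_snd)).aestronglyMeasurable
    (ae_of_all _ fun p => by
      rw [norm_mul]
      exact mul_le_mul (hf.bound _) (hg.bound _) (norm_nonneg _)
        ((norm_nonneg _).trans (hf.bound p.1)))
  refine h4.congr (ae_of_all _ fun p => ?_)
  simp only [ContinuousLinearMap.mul_apply']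
  by_cases hp1 : p.1 ∈ Ω
  · by_cases hp2 : p.2 ∈ Ω
    · have : p.1 - p.2 ∈ ball (0 : E) (R + R) := by
        have a1 := hR hp1
        have a2 := hR hp2
        simp only [mem_ball, dist_zero_right] at a1 a2 ⊢
        exact (norm_sub_le _ _).trans_lt (add_lt_add a1 a2)
      rw [indicator_of_mem hp2, indicator_of_mem this, one_mul]
    · simp [hg.zero _ hp2]
  · simp [hf.zero _ hp1]

theorem rieszForm_comm (α : ℝ) (f g : E → ℝ) : rieszForm α f g = rieszForm α g f := by
  rw [rieszForm, rieszForm, Measure.volume_eq_prod, ← integral_prod_swap]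
  refine integral_congr_ae (ae_of_all _ fun p => ?_)
  simp only [Prod.fst_swap, Prod.snd_swap, norm_sub_rev p.2 p.1]
  ring

theorem rieszForm_sub_left [Nontrivial E] {α : ℝ}
    (hα : α < Module.finrank ℝ E) {Ω : Set E} (hΩ : MeasurableSet Ω)
    (hΩb : Bornology.IsBounded Ω) {C C' D : ℝ} {f f' g : E → ℝ} (hf : IsBddSupportedOn Ω C f)
    (hf' : IsBddSupportedOn Ω C' f') (hg : IsBddSupportedOn Ω D g) :
    rieszForm α (fun x => f x - f' x) g = rieszForm α f g - rieszForm α f' g := by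
  rw [rieszForm, rieszForm, rieszForm, ← integral_sub (hf.integrable_riesz hα hΩ hΩb hg)
    (hf'.integrable_riesz hα hΩ hΩb hg)]
  simp only [sub_mul]

theorem rieszForm_const_mul_left (α c : ℝ) (f g : E → ℝ) :
    rieszForm α (fun x => c * f x) g = c * rieszForm α f g := by
  rw [rieszForm, rieszForm, ← integral_const_mul]
  simp only [mul_assoc]

theorem rieszForm_mono_left [Nontrivial E] {α : ℝ}
    (hα : α < Module.finrank ℝ E) {Ω : Set E} (hΩ : MeasurableSet Ω)
    (hΩb : Bornology.IsBounded Ω) {C C' D : ℝ} {f f' g : E → ℝ} (hf : IsBddSupportedOn Ω C f)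
    (hf' : IsBddSupportedOn Ω C' f') (hg : IsBddSupportedOn Ω D g) (h : ∀ x, f x ≤ f' x)
    (hg0 : ∀ x, 0 ≤ g x) : rieszForm α f g ≤ rieszForm α f' g := by
  refine integral_mono (hf.integrable_riesz hα hΩ hΩb hg) (hf'.integrable_riesz hα hΩ hΩb hg)
    fun p => ?_
  have := hg0 p.2
  have := h p.1
  dsimp only
  gcongr

theorem abs_rieszForm_le [Nontrivial E] {α : ℝ}
    (hα : α < Module.finrank ℝ E) {Ω : Set E} (hΩ : MeasurableSet Ω)
    (hΩb : Bornology.IsBounded Ω) {C D : ℝ} {f g : E → ℝ} (hf : IsBddSupportedOn Ω C f)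
    (hg : IsBddSupportedOn Ω D g) :
    |rieszForm α f g| ≤
      C * D * rieszForm α (Ω.indicator fun _ => (1 : ℝ)) (Ω.indicator fun _ => (1 : ℝ)) := by
  have h1 := isBddSupportedOn_indicator_one hΩ
  rw [rieszForm, rieszForm, ← integral_const_mul, ← Real.norm_eq_abs]
  refine norm_integral_le_of_norm_le ((h1.integrable_riesz hα hΩ hΩb h1).const_mul _)
    (ae_of_all _ fun p => ?_)
  by_cases hp1 : p.1 ∈ Ω
  · by_cases hp2 : p.2 ∈ Ω
    · rw [indicator_of_mem hp2, indicator_of_mem hp1, norm_mul, norm_mul, norm_inv,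
        Real.norm_of_nonneg (show 0 ≤ ‖p.1 - p.2‖ ^ α by positivity), one_mul, one_mul]
      have h2 := hf.bound p.1
      have h3 := hg.bound p.2
      have := (norm_nonneg _).trans h2
      gcongr
    · simp [hg.zero _ hp2, hp2]
  · simp [hf.zero _ hp1, hp1]

theorem rieszForm_comp_smul (α : ℝ) (f g : E → ℝ) {c : ℝ} (hc : 0 < c) :
    rieszForm α (fun x => f (c • x)) (fun x => g (c • x)) =
      c ^ (α - 2 * Module.finrank ℝ E) * rieszForm α f g := by
  have key := Measure.integral_comp_smul ((volume : Measure E).prod (volume : Measure E))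
    (fun p : E × E => f p.1 * g p.2 * (‖p.1 - p.2‖ ^ α)⁻¹) c
  rw [rieszForm, rieszForm, Measure.volume_eq_prod]
  have e : ∀ p : E × E, f (c • p.1) * g (c • p.2) * (‖p.1 - p.2‖ ^ α)⁻¹ =
      c ^ α * (f (c • p).1 * g (c • p).2 * (‖(c • p).1 - (c • p).2‖ ^ α)⁻¹) := by
    intro p
    have : ‖(c • p).1 - (c • p).2‖ ^ α = c ^ α * ‖p.1 - p.2‖ ^ α := by
      rw [Prod.smul_fst, Prod.smul_snd, ← smul_sub, norm_smul, Real.norm_of_nonneg hc.le,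
        Real.mul_rpow hc.le (norm_nonneg _)]
    rw [this, Prod.smul_fst, Prod.smul_snd, mul_inv]
    have : c ^ α ≠ 0 := (Real.rpow_pos_of_pos hc α).ne'
    field_simp
  simp only [e]
  rw [integral_const_mul, key, Module.finrank_prod, smul_eq_mul, abs_of_pos (by positivity),
    Real.rpow_sub hc, ← two_mul, ← mul_assoc, div_eq_mul_inv]
  congr 3
  rw [← Real.rpow_natCast]
  push_cast
  rfl

theorem mul_rpow_sub_one_mul_sub_le {a b p : ℝ} (ha : 0 ≤ a) (hb : 0 ≤ b) (hp : 1 < p) :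
    p * b ^ (p - 1) * (a - b) ≤ a ^ p - b ^ p := by
  rcases ha.eq_or_lt with rfl | ha0
  · rw [Real.zero_rpow (by linarith : p ≠ 0)]
    rcases hb.eq_or_lt with rfl | hb0
    · simp [Real.zero_rpow (by linarith : p ≠ 0)]
    · have : b ^ p = b ^ (p - 1) * b := by
        rw [← Real.rpow_add_one hb0.ne']; ring_nf
      rw [this]
      have := Real.rpow_pos_of_pos hb0 (p - 1)
      nlinarith [mul_pos this hb0]
  · rcases hb.eq_or_lt with rfl | hb0
    · rw [Real.zero_rpow (by linarith), Real.zero_rpow (by linarith)]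
      simpa using Real.rpow_nonneg ha p
    · have h1 := one_add_mul_self_le_rpow_one_add (s := a / b - 1)
        (by have : 0 < a / b := by positivity
            linarith) hp.le
      rw [add_sub_cancel, Real.div_rpow ha hb, le_div_iff₀ (by positivity)] at h1
      have h2 : b ^ p = b ^ (p - 1) * b := by
        rw [← Real.rpow_add_one hb0.ne']; ring_nf
      have h3 : (1 + p * (a / b - 1)) * b ^ p = b ^ p + p * b ^ (p - 1) * (a - b) := by
        rw [h2]; field_simp
      linarith

theorem abs_rpow_sub_rpow_le {a b p M : ℝ} (ha : 0 ≤ a) (hb : 0 ≤ b) (haM : a ≤ M) (hbM : b ≤ M)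
    (hp : 1 < p) : |a ^ p - b ^ p| ≤ p * M ^ (p - 1) * |a - b| := by
  have key : ∀ a b : ℝ, 0 ≤ a → 0 ≤ b → a ≤ M → a ^ p - b ^ p ≤ p * M ^ (p - 1) * |a - b| := by
    intro a b ha hb haM
    have h1 := mul_rpow_sub_one_mul_sub_le hb ha hp
    have h2 : p * a ^ (p - 1) * (a - b) ≤ p * M ^ (p - 1) * |a - b| := by
      have : a ^ (p - 1) ≤ M ^ (p - 1) := Real.rpow_le_rpow ha haM (by linarith)
      have h3 : 0 ≤ p * a ^ (p - 1) := mul_nonneg (by linarith) (Real.rpow_nonneg ha _)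
      calc p * a ^ (p - 1) * (a - b) ≤ p * a ^ (p - 1) * |a - b| := by
            gcongr; exact le_abs_self _
        _ ≤ _ := by gcongr
    linarith
  refine abs_le.2 ⟨?_, key a b ha hb haM⟩
  have := key b a hb ha hbM
  rw [abs_sub_comm] at this
  linarith

/-- If `U` and `V` are close and the Riesz energies of `U ^ p` and `V ^ p` agree, then the
derivative of the energy at `U` in the direction `U - V` is of higher order. -/
theorem rieszForm_rpow_sub_one_mul_sub_le [Nontrivial E] {α : ℝ}
    (hα : α < Module.finrank ℝ E) {Ω : Set E} (hΩ : MeasurableSet Ω)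
    (hΩb : Bornology.IsBounded Ω) {M δ ω p : ℝ} (hp : 1 < p) {U V : E → ℝ}
    (hU : IsBddSupportedOn Ω M U) (hV : IsBddSupportedOn Ω M V) (hU0 : ∀ x, 0 ≤ U x)
    (hV0 : ∀ x, 0 ≤ V x) (hδ : ∀ x, |U x - V x| ≤ δ)
    (hω : ∀ x, |U x ^ (p - 1) - V x ^ (p - 1)| ≤ ω)
    (hUV : rieszForm α (fun x => V x ^ p) (fun x => V x ^ p) =
      rieszForm α (fun x => U x ^ p) (fun x => U x ^ p)) :
    rieszForm α (fun x => U x ^ (p - 1) * (U x - V x)) (fun x => U x ^ p) ≤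
      (p * M ^ (p - 1) * M ^ (p - 1) / 2 * δ + M ^ p * ω) * δ *
        rieszForm α (Ω.indicator fun _ => (1 : ℝ)) (Ω.indicator fun _ => (1 : ℝ)) := by
  set K := rieszForm α (Ω.indicator fun _ : E => (1 : ℝ)) (Ω.indicator fun _ => (1 : ℝ)) with hK
  have hp0 : 0 < p := by linarith
  have bU := hU.rpow hU0 hp0
  have bV := hV.rpow hV0 hp0
  have bU1 := hU.rpow hU0 (sub_pos.2 hp)
  have bV1 := hV.rpow hV0 (sub_pos.2 hp)
  have bsub : IsBddSupportedOn Ω δ (fun x => U x - V x) := ⟨(hU.sub hV).measurable, hδ,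
    (hU.sub hV).zero⟩
  have bsub1 : IsBddSupportedOn Ω ω (fun x => U x ^ (p - 1) - V x ^ (p - 1)) :=
    ⟨(bU1.sub bV1).measurable, hω, (bU1.sub bV1).zero⟩
  have bsubp : IsBddSupportedOn Ω (p * M ^ (p - 1) * δ) (fun x => U x ^ p - V x ^ p) := by
    refine ⟨(bU.sub bV).measurable, fun x => ?_, (bU.sub bV).zero⟩
    have hUM := (le_abs_self _).trans (hU.bound x)
    have hVM := (le_abs_self _).trans (hV.bound x)
    have hM : 0 ≤ M := (hU0 x).trans hUM
    refine (abs_rpow_sub_rpow_le (hU0 x) (hV0 x) hUM hVM hp).trans ?_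
    gcongr
    exact hδ x
  have e1 : rieszForm α (fun x => U x ^ p - V x ^ p) (fun x => U x ^ p - V x ^ p) =
      2 * rieszForm α (fun x => U x ^ p - V x ^ p) (fun x => U x ^ p) := by
    rw [rieszForm_sub_left hα hΩ hΩb bU bV bsubp, rieszForm_comm α (fun x => U x ^ p),
      rieszForm_comm α (fun x => V x ^ p), rieszForm_sub_left hα hΩ hΩb bU bV bU,
      rieszForm_sub_left hα hΩ hΩb bU bV bV, hUV, rieszForm_comm α (fun x => V x ^ p)]
    ring
  have b1 := (abs_le.1 (abs_rieszForm_le hα hΩ hΩb bsubp bsubp)).2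
  have b2 := (abs_le.1 (abs_rieszForm_le hα hΩ hΩb (bsub1.mul bsub) bU)).2
  have bd := (bsubp.const_mul p⁻¹)
  have bneg := (bsub1.mul bsub).const_mul (-1)
  have mono := rieszForm_mono_left hα hΩ hΩb (bU1.mul bsub) (bd.sub bneg) bU (fun x => by
    have h1 := mul_rpow_sub_one_mul_sub_le (hU0 x) (hV0 x) hp
    have h2 : V x ^ (p - 1) * (U x - V x) ≤ p⁻¹ * (U x ^ p - V x ^ p) := by
      rw [inv_mul_eq_div, le_div_iff₀ hp0]; linarith
    linarith) (fun x => Real.rpow_nonneg (hU0 x) p)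
  rw [rieszForm_sub_left hα hΩ hΩb bd bneg bU, rieszForm_const_mul_left,
    rieszForm_const_mul_left] at mono
  have h3 : p⁻¹ * rieszForm α (fun x => U x ^ p - V x ^ p) (fun x => U x ^ p) ≤
      p * M ^ (p - 1) * M ^ (p - 1) / 2 * δ * δ * K := by
    rw [inv_mul_eq_div, div_le_iff₀ hp0]
    nlinarith
  linarith

end Riesz

/-- `V` is nonnegative, bounded by `B`, `L`-Lipschitz, and vanishes outside `Ω`. -/
structure IsLipSupportedOn {E : Type*} [NormedAddCommGroup E] (Ω : Set E) (L B : ℝ≥0)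
    (V : E → ℝ) : Prop where
  lipschitz : LipschitzWith L V
  bound : ∀ x, ‖V x‖ ≤ B
  nonneg : ∀ x, 0 ≤ V x
  zero : ∀ x ∉ Ω, V x = 0

/-- The Dirichlet form `(f, g) ↦ ∫ ∇f · ∇g` on `ℝⁿ`. -/
noncomputable def dirichletForm (n : ℕ) (f g : EuclideanSpace ℝ (Fin n) → ℝ) : ℝ :=
  ∑ i : Fin n, ∫ x, fderiv ℝ f x (EuclideanSpace.single i 1) *
    fderiv ℝ g x (EuclideanSpace.single i 1)

theorem IsBddSupportedOn.integrable {E : Type*} [MeasurableSpace E] {μ : Measure E} {Ω : Set E}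
    (hΩ : μ Ω ≠ ⊤) {C : ℝ} {f : E → ℝ} (hf : IsBddSupportedOn Ω C f) : Integrable f μ :=
  integrable_of_bounded_of_eq_zero hΩ hf.measurable.aestronglyMeasurable
    (fun x _ => hf.bound x) hf.zero

section Lip

variable {E : Type*} [NormedAddCommGroup E] {Ω : Set E} {L B : ℝ≥0} {V : E → ℝ}

theorem IsLipSupportedOn.isBddSupportedOn [MeasurableSpace E] [BorelSpace E]
    (hV : IsLipSupportedOn Ω L B V) : IsBddSupportedOn Ω B V :=
  ⟨hV.lipschitz.continuous.measurable, hV.bound, hV.zero⟩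

variable [NormedSpace ℝ E]

theorem IsLipSupportedOn.fderiv_eq_zero (hV : IsLipSupportedOn Ω L B V) {x : E} (hx : x ∉ Ω) :
    fderiv ℝ V x = 0 :=
  (isLocalMin_of_nonneg_of_eq_zero hV.nonneg (hV.zero x hx)).fderiv_eq_zero

theorem IsLipSupportedOn.isBddSupportedOn_fderiv [MeasurableSpace E] [BorelSpace E]
    (hV : IsLipSupportedOn Ω L B V) (v : E) :
    IsBddSupportedOn Ω (L * ‖v‖) (fun x => fderiv ℝ V x v) :=
  ⟨measurable_fderiv_apply_const ℝ V v,
    fun x => (fderiv ℝ V x).le_of_opNorm_le (norm_fderiv_le_of_lipschitz ℝ hV.lipschitz) v,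
    fun x hx => by simp [hV.fderiv_eq_zero hx]⟩

theorem IsLipSupportedOn.dilate (hV : IsLipSupportedOn Ω L B V) (hstar : StarConvex ℝ 0 Ω)
    (κ : ℝ≥0) {μ : ℝ≥0} (hμ : 1 ≤ μ) :
    IsLipSupportedOn Ω (κ * (L * μ)) (κ * B) (fun x => κ * V (μ • x)) where
  lipschitz := by
    refine LipschitzWith.of_dist_le_mul fun x y => ?_
    have h := hV.lipschitz.dist_le_mul (μ • x) (μ • y)
    rw [Real.dist_eq, ← mul_sub, abs_mul, ← Real.dist_eq, abs_of_nonneg κ.coe_nonneg]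
    rw [NNReal.smul_def, NNReal.smul_def, dist_smul₀, Real.norm_of_nonneg μ.coe_nonneg] at h
    push_cast
    calc _ ≤ (κ : ℝ) * (L * (μ * dist x y)) := by gcongr; exact h
      _ = _ := by ring
  bound x := by
    rw [norm_mul, Real.norm_of_nonneg κ.coe_nonneg]
    push_cast
    gcongr
    exact hV.bound _
  nonneg x := mul_nonneg κ.coe_nonneg (hV.nonneg _)
  zero x hx := by
    rw [hV.zero, mul_zero]
    intro h
    have := hstar.smul_mem h (t := (μ : ℝ)⁻¹) (by positivity) (inv_le_one_of_one_le₀ hμ)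
    rw [NNReal.smul_def, inv_smul_smul₀ (by positivity)] at this
    exact hx this

end Lip

section Dirichlet

variable {n : ℕ} {Ω : Set (EuclideanSpace ℝ (Fin n))} {L B L' B' : ℝ≥0}
  {U V : EuclideanSpace ℝ (Fin n) → ℝ}

theorem integrable_fderiv_mul_fderiv (hΩb : Bornology.IsBounded Ω)
    (hU : IsLipSupportedOn Ω L B U) (hV : IsLipSupportedOn Ω L' B' V)
    (v : EuclideanSpace ℝ (Fin n)) :
    Integrable (fun x => fderiv ℝ U x v * fderiv ℝ V x v) :=
  ((hU.isBddSupportedOn_fderiv v).mul (hV.isBddSupportedOn_fderiv v)).integrable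
    hΩb.measure_lt_top.ne

theorem dirichletForm_sub_sub (hΩb : Bornology.IsBounded Ω)
    (hU : IsLipSupportedOn Ω L B U) (hV : IsLipSupportedOn Ω L' B' V) :
    Integrable (fun x => ∑ i : Fin n, (fderiv ℝ U x (EuclideanSpace.single i 1) -
      fderiv ℝ V x (EuclideanSpace.single i 1)) ^ 2) ∧
    ∫ x, ∑ i : Fin n, (fderiv ℝ U x (EuclideanSpace.single i 1) -
      fderiv ℝ V x (EuclideanSpace.single i 1)) ^ 2 =
      dirichletForm n U U - 2 * dirichletForm n U V + dirichletForm n V V := by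
  have h1 := integrable_fderiv_mul_fderiv hΩb hU hU
  have h2 := integrable_fderiv_mul_fderiv hΩb hU hV
  have h3 := integrable_fderiv_mul_fderiv hΩb hV hV
  have e : ∀ i : Fin n, (fun x => (fderiv ℝ U x (EuclideanSpace.single i 1) -
      fderiv ℝ V x (EuclideanSpace.single i 1)) ^ 2) = fun x =>
      (fderiv ℝ U x (EuclideanSpace.single i 1) * fderiv ℝ U x (EuclideanSpace.single i 1) -
      2 * (fderiv ℝ U x (EuclideanSpace.single i 1) *
        fderiv ℝ V x (EuclideanSpace.single i 1))) +
      fderiv ℝ V x (EuclideanSpace.single i 1) * fderiv ℝ V x (EuclideanSpace.single i 1) :=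
    fun i => by ext x; ring
  have hint : ∀ i : Fin n, Integrable (fun x => (fderiv ℝ U x (EuclideanSpace.single i 1) -
      fderiv ℝ V x (EuclideanSpace.single i 1)) ^ 2) := fun i => by
    rw [e i]; exact ((h1 _).sub ((h2 _).const_mul 2)).add (h3 _)
  refine ⟨integrable_finsetSum _ fun i _ => hint i, ?_⟩
  rw [integral_finsetSum _ fun i _ => hint i]
  simp only [dirichletForm, Finset.mul_sum, ← Finset.sum_sub_distrib, ← Finset.sum_add_distrib]
  refine Finset.sum_congr rfl fun i _ => ?_
  have a := integral_sub (h1 (EuclideanSpace.single i 1))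
    ((h2 (EuclideanSpace.single i 1)).const_mul 2)
  have b := integral_add ((h1 (EuclideanSpace.single i 1)).sub
    ((h2 (EuclideanSpace.single i 1)).const_mul 2)) (h3 (EuclideanSpace.single i 1))
  simp only [Pi.sub_apply] at a b
  rw [e i, b, a, integral_const_mul]

theorem dirichletForm_indicator_eq_integral_mul_lap (hΩ : IsOpen Ω)
    (hΩb : Bornology.IsBounded Ω) {u : EuclideanSpace ℝ (Fin n) → ℝ} {M M₂ : ℝ≥0}
    (hu : ∀ x ∈ Ω, ContDiffAt ℝ 2 u x) (hu0 : ∀ x ∈ Ω, 0 ≤ u x)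
    (hM : ∀ x ∈ Ω, ‖fderiv ℝ u x‖ ≤ M) (hM₂ : ∀ x ∈ Ω, ‖fderiv ℝ (fderiv ℝ u) x‖ ≤ M₂)
    (hV : IsLipSupportedOn Ω L B V) :
    Integrable (fun x => V x * -lap n u x) ∧
      dirichletForm n (Ω.indicator u) V = ∫ x, V x * -lap n u x := by
  have h := fun i : Fin n => integral_fderiv_indicator_mul_fderiv (μ := volume) hΩ hΩb hu hu0 hM
    hM₂ hV.lipschitz hV.bound hV.nonneg hV.zero (EuclideanSpace.single i 1)
  have e : (fun x => V x * -lap n u x) = fun x => ∑ i : Fin n, V x *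
      -fderiv ℝ (fun z => fderiv ℝ u z (EuclideanSpace.single i 1)) x
        (EuclideanSpace.single i 1) := by
    ext x
    rw [lap, ← Finset.sum_neg_distrib, Finset.mul_sum]
  rw [e]
  refine ⟨integrable_finsetSum _ fun i _ => (h i).1, ?_⟩
  rw [integral_finsetSum _ fun i _ => (h i).1, dirichletForm]
  exact Finset.sum_congr rfl fun i _ => (h i).2

theorem dirichletForm_dilate (U : EuclideanSpace ℝ (Fin n) → ℝ) {μ : ℝ≥0} (hμ : 0 < μ) :
    dirichletForm n (fun x => ((μ ^ (((n : ℝ) - 2) / 2) : ℝ≥0) : ℝ) * U (μ • x))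
      (fun x => ((μ ^ (((n : ℝ) - 2) / 2) : ℝ≥0) : ℝ) * U (μ • x)) = dirichletForm n U U := by
  set κ : ℝ≥0 := μ ^ (((n : ℝ) - 2) / 2) with hκ
  have hμ0 : (0 : ℝ) < μ := hμ
  have hk : (κ : ℝ) ^ 2 * (μ : ℝ) ^ 2 * ((μ : ℝ) ^ n)⁻¹ = 1 := by
    rw [hκ, NNReal.coe_rpow, ← Real.rpow_natCast, ← Real.rpow_natCast, ← Real.rpow_natCast,
      ← Real.rpow_mul hμ0.le, ← Real.rpow_add hμ0, ← Real.rpow_neg hμ0.le, ← Real.rpow_add hμ0]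
    convert Real.rpow_zero (μ : ℝ) using 2
    push_cast
    ring
  have e : ∀ x v, fderiv ℝ (fun x => (κ : ℝ) * U (μ • x)) x v = κ * μ * fderiv ℝ U (μ • x) v := by
    intro x v
    have h1 : fderiv ℝ (fun x => (κ : ℝ) * U (μ • x)) x =
        (κ : ℝ) • fderiv ℝ (fun x => U (μ • x)) x := by
      have := fderiv_const_smul_field (𝕜 := ℝ) (κ : ℝ) (f := fun x => U (μ • x))
      exact congrFun this x
    have h2 : fderiv ℝ (fun x => U (μ • x)) x = (μ : ℝ) • fderiv ℝ U ((μ : ℝ) • x) :=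
      fderiv_comp_smul (μ : ℝ)
    rw [h1, h2]
    simp [NNReal.smul_def, mul_assoc]
  simp only [dirichletForm, e]
  refine Finset.sum_congr rfl fun i _ => ?_
  have := Measure.integral_comp_smul (volume : Measure (EuclideanSpace ℝ (Fin n)))
    (fun x => fderiv ℝ U x (EuclideanSpace.single i 1) * fderiv ℝ U x (EuclideanSpace.single i 1))
    (μ : ℝ)
  rw [finrank_euclideanSpace_fin, abs_of_pos (by positivity)] at this
  calc _ = ∫ x, (κ : ℝ) ^ 2 * (μ : ℝ) ^ 2 * (fderiv ℝ U ((μ : ℝ) • x) (EuclideanSpace.single i 1) *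
          fderiv ℝ U ((μ : ℝ) • x) (EuclideanSpace.single i 1)) := by
        congr 1; ext x; rw [NNReal.smul_def]; ring
    _ = _ := by rw [integral_const_mul, this, smul_eq_mul, ← mul_assoc, hk, one_mul]

end Dirichlet

/-- The dilation `μ ^ ((n - 2) / 2) * U (μ x)`, which preserves the Dirichlet energy on `ℝⁿ`. -/
noncomputable def dilation (n : ℕ) (U : EuclideanSpace ℝ (Fin n) → ℝ) (μ : ℝ≥0) :
    EuclideanSpace ℝ (Fin n) → ℝ :=
  fun x => ((μ ^ (((n : ℝ) - 2) / 2) : ℝ≥0) : ℝ) * U (μ • x)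

section

variable {n : ℕ} {Ω : Set (EuclideanSpace ℝ (Fin n))} {L B : ℝ≥0}
  {U : EuclideanSpace ℝ (Fin n) → ℝ}

theorem IsLipSupportedOn.exists_abs_sub_dilation_le (hU : IsLipSupportedOn Ω L B U)
    (hΩb : Bornology.IsBounded Ω) (hstar : StarConvex ℝ 0 Ω) :
    ∃ C : ℝ, 0 ≤ C ∧ ∀ᶠ μ in 𝓝[>] (1 : ℝ≥0), ∀ x, |U x - dilation n U μ x| ≤ C * (μ - 1) := by
  obtain ⟨R, hR0, hR⟩ := hΩb.exists_pos_norm_le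
  have h1 := (Real.hasDerivAt_rpow_const (x := 1) (p := ((n : ℝ) - 2) / 2)
    (Or.inl one_ne_zero)).isBigO_sub
  obtain ⟨c, hc0, hc⟩ := h1.exists_nonneg
  have hc' := ((NNReal.continuous_coe.tendsto' 1 (1 : ℝ) (by simp)).eventually hc.bound)
  refine ⟨L * R + c * B, by positivity, ?_⟩
  filter_upwards [nhdsWithin_le_nhds hc', self_mem_nhdsWithin] with μ hμ hμ1 x
  have hμ1' : (1 : ℝ) < μ := by exact_mod_cast hμ1
  by_cases hx : x ∈ Ω
  · rw [Real.one_rpow, Real.norm_eq_abs, Real.norm_of_nonneg (by linarith : (0 : ℝ) ≤ μ - 1)] at hμ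
    have a1 : |U x - U (μ • x)| ≤ L * ((μ - 1) * R) := by
      have := hU.lipschitz.dist_le_mul x (μ • x)
      have e : dist x (μ • x) = (μ - 1) * ‖x‖ := by
        rw [dist_comm, dist_eq_norm, NNReal.smul_def]
        nth_rw 2 [← one_smul ℝ x]
        rw [← sub_smul, norm_smul, Real.norm_of_nonneg (by linarith : (0 : ℝ) ≤ μ - 1)]
      rw [e, Real.dist_eq] at this
      refine this.trans ?_
      have : 0 ≤ (μ : ℝ) - 1 := by linarith
      gcongr
      exact hR x hx
    have a2 : |(1 - (μ : ℝ) ^ (((n : ℝ) - 2) / 2)) * U (μ • x)| ≤ c * (μ - 1) * B := by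
      rw [abs_mul, abs_sub_comm]
      gcongr
      exact hU.bound _
    have e : U x - dilation n U μ x =
        (U x - U (μ • x)) + (1 - (μ : ℝ) ^ (((n : ℝ) - 2) / 2)) * U (μ • x) := by
      rw [dilation, NNReal.coe_rpow]; ring
    rw [e]
    refine (abs_add_le _ _).trans ?_
    linarith
  · rw [hU.zero x hx, dilation, (hU.dilate hstar (μ ^ (((n : ℝ) - 2) / 2)) hμ1.le).zero x hx]
    simp only [sub_zero, abs_zero]
    have : 0 ≤ (μ : ℝ) - 1 := by linarith
    positivity

theorem rieszForm_dilation_rpow (hU : ∀ x, 0 ≤ U x) {α : ℝ} (hn : 2 < n) {μ : ℝ≥0} (hμ : 0 < μ) :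
    rieszForm α (fun x => dilation n U μ x ^ ((2 * (n : ℝ) - α) / ((n : ℝ) - 2)))
      (fun x => dilation n U μ x ^ ((2 * (n : ℝ) - α) / ((n : ℝ) - 2))) =
    rieszForm α (fun x => U x ^ ((2 * (n : ℝ) - α) / ((n : ℝ) - 2)))
      (fun x => U x ^ ((2 * (n : ℝ) - α) / ((n : ℝ) - 2))) := by
  set p := (2 * (n : ℝ) - α) / ((n : ℝ) - 2) with hp
  have hμ0 : (0 : ℝ) < μ := hμ
  have hn2 : (0 : ℝ) < (n : ℝ) - 2 := by
    have : (2 : ℝ) < n := by exact_mod_cast hn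
    linarith
  have e : (fun x => dilation n U μ x ^ p) = fun x =>
      ((μ : ℝ) ^ (((n : ℝ) - 2) / 2)) ^ p * (fun y => U y ^ p) ((μ : ℝ) • x) := by
    ext x
    rw [dilation, NNReal.coe_rpow, Real.mul_rpow (by positivity) (hU _), NNReal.smul_def]
  rw [e, rieszForm_const_mul_left, rieszForm_comm, rieszForm_const_mul_left,
    rieszForm_comp_smul α (fun y => U y ^ p) (fun y => U y ^ p) hμ0, ← mul_assoc, ← mul_assoc]
  convert one_mul _
  rw [← Real.rpow_mul hμ0.le, ← Real.rpow_add hμ0, ← Real.rpow_add hμ0,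
    finrank_euclideanSpace_fin]
  convert Real.rpow_zero (μ : ℝ) using 2
  rw [hp]
  field_simp
  ring

/-- Weak form of the Hartree equation tested with a function vanishing outside `Ω`. -/
theorem integral_mul_lap_eq_rieszForm (hΩ : IsOpen Ω) (hΩb : Bornology.IsBounded Ω)
    [Nonempty (Fin n)] {α p : ℝ} (hαn : α < n) (hp : 1 < p) {C D : ℝ}
    {u W : EuclideanSpace ℝ (Fin n) → ℝ} (hU : IsBddSupportedOn Ω C (Ω.indicator u))
    (hU0 : ∀ x, 0 ≤ Ω.indicator u x) (hW : IsBddSupportedOn Ω D W)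
    (heq : ∀ x ∈ Ω, -(lap n u x) = (∫ y in Ω, u y ^ p / ‖x - y‖ ^ α) * u x ^ (p - 1)) :
    ∫ x, W x * -lap n u x =
      rieszForm α (fun x => Ω.indicator u x ^ (p - 1) * W x) (fun x => Ω.indicator u x ^ p) := by
  have h1 := ((hU.rpow hU0 (sub_pos.2 hp)).mul hW).integrable_riesz (α := α)
    (by rwa [finrank_euclideanSpace_fin]) hΩ.measurableSet hΩb (hU.rpow hU0 (by linarith : 0 < p))
  rw [rieszForm, Measure.volume_eq_prod, integral_prod _ h1]
  refine integral_congr_ae (ae_of_all _ fun x => ?_)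
  by_cases hx : x ∈ Ω
  · simp only [heq x hx, mul_assoc, integral_const_mul]
    rw [indicator_of_mem hx, ← integral_indicator hΩ.measurableSet]
    have : (Ω.indicator fun y => u y ^ p / ‖x - y‖ ^ α) =
        fun y => Ω.indicator u y ^ p * (‖x - y‖ ^ α)⁻¹ := by
      ext y
      by_cases hy : y ∈ Ω
      · simp [hy, div_eq_mul_inv]
      · simp [hy, Real.zero_rpow (by linarith : p ≠ 0)]
    rw [this]
    ring
  · simp [hW.zero x hx]

/-- Along the energy-preserving dilations, the Dirichlet distance squared between a solution and
its dilation is of higher order. -/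
theorem eventually_dirichlet_sub_dilation_le (hn : 3 ≤ n) (hΩ : IsOpen Ω)
    (hΩb : Bornology.IsBounded Ω) (hstar : StarConvex ℝ 0 Ω) {α : ℝ} (hαn : α < n)
    {u : EuclideanSpace ℝ (Fin n) → ℝ} {M M₂ : ℝ≥0} (hu : ∀ x ∈ Ω, ContDiffAt ℝ 2 u x)
    (hu0 : ∀ x ∈ Ω, 0 ≤ u x)
    (hM : ∀ x ∈ Ω, ‖fderiv ℝ u x‖ ≤ M) (hM₂ : ∀ x ∈ Ω, ‖fderiv ℝ (fderiv ℝ u) x‖ ≤ M₂)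
    (hU : IsLipSupportedOn Ω L B (Ω.indicator u))
    (heq : ∀ x ∈ Ω, -(lap n u x) =
      (∫ y in Ω, u y ^ ((2 * (n : ℝ) - α) / ((n : ℝ) - 2)) / ‖x - y‖ ^ α) *
        u x ^ ((2 * (n : ℝ) - α) / ((n : ℝ) - 2) - 1)) {η : ℝ} (hη : 0 < η) :
    ∀ᶠ μ in 𝓝[>] (1 : ℝ≥0),
      ∫ x, ∑ i : Fin n, (fderiv ℝ (Ω.indicator u) x (EuclideanSpace.single i 1) -
        fderiv ℝ (dilation n (Ω.indicator u) μ) x (EuclideanSpace.single i 1)) ^ 2 ≤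
      η * (μ - 1) := by
  have : Nonempty (Fin n) := ⟨⟨0, by omega⟩⟩
  set p := (2 * (n : ℝ) - α) / ((n : ℝ) - 2) with hpdef
  set U := Ω.indicator u with hUdef
  have hn3 : (3 : ℝ) ≤ n := by exact_mod_cast hn
  have hp : 1 < p := by
    rw [hpdef, lt_div_iff₀ (by linarith)]; linarith
  obtain ⟨C, hC0, hC⟩ := hU.exists_abs_sub_dilation_le hΩb hstar
  set K := rieszForm α (Ω.indicator fun _ : EuclideanSpace ℝ (Fin n) => (1 : ℝ))
    (Ω.indicator fun _ => (1 : ℝ)) with hK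
  have hK0 : 0 ≤ K := integral_nonneg fun q => by
    have : ∀ x, 0 ≤ Ω.indicator (fun _ => (1 : ℝ)) x := fun x =>
      indicator_nonneg (fun _ _ => zero_le_one) x
    have := mul_nonneg (this q.1) (this q.2)
    dsimp only [Pi.zero_apply]
    positivity
  set M' : ℝ := B + 1 with hM'
  have hM'0 : 0 ≤ M' := by positivity
  set c₁ := p * M' ^ (p - 1) * M' ^ (p - 1) / 2 with hc₁
  have hc₁0 : 0 ≤ c₁ := by positivity
  set c₂ := M' ^ p with hc₂
  have hc₂0 : 0 ≤ c₂ := by positivity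
  set ε : ℝ := η / (4 * (c₂ * C * K + 1)) with hε
  have hε0 : 0 < ε := by positivity
  have hεle : 2 * (c₂ * ε) * C * K ≤ η / 2 := by
    have : ε * (c₂ * C * K + 1) = η / 4 := by rw [hε]; field_simp
    nlinarith
  have huc : UniformContinuousOn (fun t : ℝ => t ^ (p - 1)) (Icc 0 M') :=
    isCompact_Icc.uniformContinuousOn_of_continuous
      (Real.continuous_rpow_const (by linarith)).continuousOn
  obtain ⟨d, hd0, hd⟩ := Metric.uniformContinuousOn_iff.1 huc ε hε0
  have htend : Tendsto (fun μ : ℝ≥0 => C * ((μ : ℝ) - 1)) (𝓝[>] 1) (𝓝 0) := by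
    have : Continuous fun μ : ℝ≥0 => C * ((μ : ℝ) - 1) := by fun_prop
    exact (this.tendsto' 1 0 (by simp)).mono_left nhdsWithin_le_nhds
  have htend2 : Tendsto (fun μ : ℝ≥0 => 2 * (c₁ * (C * ((μ : ℝ) - 1))) * C * K) (𝓝[>] 1)
      (𝓝 0) := by
    have : Continuous fun μ : ℝ≥0 => 2 * (c₁ * (C * ((μ : ℝ) - 1))) * C * K := by fun_prop
    exact (this.tendsto' 1 0 (by simp)).mono_left nhdsWithin_le_nhds
  filter_upwards [hC, htend.eventually (gt_mem_nhds hd0), htend.eventually (gt_mem_nhds one_pos),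
    htend2.eventually (gt_mem_nhds (half_pos hη)), self_mem_nhdsWithin] with μ hμC hμd hμ1 hμη hμ
  have hμ1' : (1 : ℝ) < μ := by exact_mod_cast hμ
  have hμpos : (0 : ℝ) < μ - 1 := by linarith
  have hV : IsLipSupportedOn Ω _ _ (dilation n U μ) :=
    hU.dilate hstar (μ ^ (((n : ℝ) - 2) / 2)) hμ.le
  have bU : IsBddSupportedOn Ω M' U := ⟨hU.isBddSupportedOn.measurable,
    fun x => (hU.bound x).trans (by rw [hM']; linarith), hU.zero⟩
  have bV : IsBddSupportedOn Ω M' (dilation n U μ) := ⟨hV.isBddSupportedOn.measurable,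
    fun x => by
      have h1 := hU.bound x
      have h2 := abs_sub_abs_le_abs_sub (dilation n U μ x) (U x)
      rw [abs_sub_comm] at h2
      rw [Real.norm_eq_abs] at h1 ⊢
      linarith [hμC x], hV.zero⟩
  have hmem : ∀ {W : EuclideanSpace ℝ (Fin n) → ℝ}, IsBddSupportedOn Ω M' W → (∀ x, 0 ≤ W x) →
      ∀ x, W x ∈ Icc 0 M' := fun hW hW0 x => ⟨hW0 x, (le_abs_self _).trans (hW.bound x)⟩
  have key := rieszForm_rpow_sub_one_mul_sub_le (α := α)
    (by rwa [finrank_euclideanSpace_fin]) hΩ.measurableSet hΩb hp bU bV hU.nonneg hV.nonneg hμC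
    (fun x => by
      rw [← Real.dist_eq]
      refine (hd _ (hmem bU hU.nonneg x) _ (hmem bV hV.nonneg x) ?_).le
      rw [Real.dist_eq]
      exact (hμC x).trans_lt hμd)
    (rieszForm_dilation_rpow hU.nonneg (by omega) (zero_lt_one.trans hμ))
  rw [← integral_mul_lap_eq_rieszForm hΩ hΩb hαn hp bU hU.nonneg (bU.sub bV) heq] at key
  obtain ⟨i1, e1⟩ := dirichletForm_indicator_eq_integral_mul_lap hΩ hΩb hu hu0 hM hM₂ hU
  obtain ⟨i2, e2⟩ := dirichletForm_indicator_eq_integral_mul_lap hΩ hΩb hu hu0 hM hM₂ hV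
  rw [(dirichletForm_sub_sub hΩb hU hV).2, show dirichletForm n (dilation n U μ) (dilation n U μ) =
    dirichletForm n U U from dirichletForm_dilate U (zero_lt_one.trans hμ)]
  simp only [sub_mul] at key
  rw [integral_sub i1 i2, ← e1, ← e2, ← hUdef] at key
  rw [← hc₁, ← hc₂, ← hK] at key
  have : (2 * (c₁ * (C * ((μ : ℝ) - 1))) * C * K) * (μ - 1) ≤ η / 2 * (μ - 1) := by gcongr
  have : (2 * (c₂ * ε) * C * K) * (μ - 1) ≤ η / 2 * (μ - 1) := by gcongr
  linarith

end

theorem le_measureReal_diff_preimage_smul {E : Type*} [NormedAddCommGroup E] [NormedSpace ℝ E]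
    [FiniteDimensional ℝ E] [Nontrivial E] [MeasurableSpace E] [BorelSpace E] {ν : Measure E}
    [ν.IsAddHaarMeasure] {S : Set E} (hS : MeasurableSet S) (hSfin : ν S ≠ ⊤) {μ : ℝ}
    (hμ : 1 < μ) (hμ2 : μ ≤ 2) (h : ∀ x, μ • x ∈ S → x ∈ S) :
    ν.real S / 2 * (μ - 1) ≤ ν.real (S \ (μ • ·) ⁻¹' S) := by
  have hμ0 : 0 < μ := by linarith
  rw [measureReal_sdiff (show (μ • ·) ⁻¹' S ⊆ S from h) (measurable_const_smul μ hS) hSfin]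
  have e : ν.real ((μ • ·) ⁻¹' S) = (μ ^ Module.finrank ℝ E)⁻¹ * ν.real S := by
    rw [measureReal_def, Measure.addHaar_preimage_smul ν hμ0.ne', ENNReal.toReal_mul,
      ENNReal.toReal_ofReal (abs_nonneg _), abs_of_pos (by positivity), measureReal_def]
  have h1 : (μ ^ Module.finrank ℝ E)⁻¹ ≤ μ⁻¹ :=
    inv_anti₀ hμ0 (le_self_pow₀ hμ.le Module.finrank_pos.ne')
  have h2 : μ⁻¹ ≤ 1 - (μ - 1) / 2 := by
    rw [inv_le_iff_one_le_mul₀ hμ0]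
    nlinarith
  have h3 := mul_le_mul_of_nonneg_right (h1.trans h2) (measureReal_nonneg (μ := ν) (s := S))
  rw [e]
  linarith

section

variable {n : ℕ} {Ω : Set (EuclideanSpace ℝ (Fin n))} {L B : ℝ≥0}
  {U : EuclideanSpace ℝ (Fin n) → ℝ}

/-- If the gradient of `U` does not degenerate near the boundary point `z` and `z` is in the
closure of the exterior of `Ω`, then `U` and its dilations are linearly far in Dirichlet norm
squared: on the part of `Ω` that the dilation moves out of `Ω`, the dilated function vanishes. -/
theorem IsLipSupportedOn.exists_le_dirichlet_sub_dilation [Nonempty (Fin n)] (hΩ : IsOpen Ω)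
    (hΩb : Bornology.IsBounded Ω) (hstar : StarConvex ℝ 0 Ω) (hU : IsLipSupportedOn Ω L B U)
    {z : EuclideanSpace ℝ (Fin n)} (hz0 : 0 < ‖z‖) (hz : ball 0 ‖z‖ ⊆ Ω)
    (hzi : z ∉ interior (closure Ω)) {c ρ : ℝ} (hc : 0 < c) (hρ : 0 < ρ)
    (hgrad : ∀ x ∈ Ω ∩ ball z ρ, c ≤ ∑ i : Fin n, fderiv ℝ U x (EuclideanSpace.single i 1) ^ 2) :
    ∃ c' : ℝ, 0 < c' ∧ ∀ᶠ μ in 𝓝[>] (1 : ℝ≥0), c' * (μ - 1) ≤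
      ∫ x, ∑ i : Fin n, (fderiv ℝ U x (EuclideanSpace.single i 1) -
        fderiv ℝ (dilation n U μ) x (EuclideanSpace.single i 1)) ^ 2 := by
  have hzc : z ∈ closure (closure Ω)ᶜ := by rwa [closure_compl]
  obtain ⟨e, heΩ, hez⟩ := Metric.mem_closure_iff.1 hzc (ρ / 4) (by positivity)
  have hopen : IsOpen ((closure Ω)ᶜ ∩ ball z (ρ / 4)) :=
    isClosed_closure.isOpen_compl.inter isOpen_ball
  obtain ⟨s, hs0, hs⟩ := Metric.isOpen_iff.1 hopen e ⟨heΩ, by rwa [mem_ball']⟩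
  set S : Set (EuclideanSpace ℝ (Fin n)) := Ω ∩ ⋃ t ∈ Ioi (0 : ℝ), (t • ·) ⁻¹' ball e s with hS
  have hSo : IsOpen S := hΩ.inter (isOpen_biUnion fun t _ =>
    isOpen_ball.preimage (continuous_const_smul t))
  have hSne : S.Nonempty := by
    set τ : ℝ := ‖z‖ / (2 * (‖e‖ + 1)) with hτ
    have hτ0 : 0 < τ := by positivity
    refine ⟨τ • e, hz ?_, mem_biUnion (x := τ⁻¹) (by simpa using hτ0) ?_⟩
    · rw [mem_ball_zero_iff, norm_smul, Real.norm_of_nonneg hτ0.le, hτ, div_mul_eq_mul_div,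
        div_lt_iff₀ (by positivity)]
      nlinarith [norm_nonneg e]
    · simp [smul_smul, inv_mul_cancel₀ hτ0.ne', hs0]
  have hSfin : volume S ≠ ⊤ := ((measure_mono inter_subset_left).trans_lt hΩb.measure_lt_top).ne
  have hSpos : 0 < volume.real S :=
    ENNReal.toReal_pos (hSo.measure_pos volume hSne).ne' hSfin
  refine ⟨c * (volume.real S / 2), by positivity, ?_⟩
  have htend : Tendsto (fun μ : ℝ≥0 => ‖z‖ * ((μ : ℝ) - 1)) (𝓝[>] 1) (𝓝 0) := by
    have : Continuous fun μ : ℝ≥0 => ‖z‖ * ((μ : ℝ) - 1) := by fun_prop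
    exact (this.tendsto' 1 0 (by simp)).mono_left nhdsWithin_le_nhds
  filter_upwards [self_mem_nhdsWithin,
    htend.eventually (gt_mem_nhds (show 0 < ρ / 4 by positivity)),
    nhdsWithin_le_nhds (Iic_mem_nhds one_lt_two)] with μ hμ hμρ hμ2
  have hμ1 : (1 : ℝ) < μ := by exact_mod_cast hμ
  have hμ0 : (0 : ℝ) < μ := by linarith
  have hμ2' : (μ : ℝ) ≤ 2 := by exact_mod_cast hμ2
  have hV : IsLipSupportedOn Ω _ _ (dilation n U μ) :=
    hU.dilate hstar (μ ^ (((n : ℝ) - 2) / 2)) hμ.le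
  have hvol := le_measureReal_diff_preimage_smul (ν := volume) hSo.measurableSet hSfin hμ1 hμ2'
    (fun x hx => by
      obtain ⟨hxΩ, hxC⟩ := hx
      simp only [mem_iUnion] at hxC
      obtain ⟨t, ht, hxt⟩ := hxC
      refine ⟨?_, mem_biUnion (x := t * μ) (mul_pos ht hμ0) ?_⟩
      · have := hstar.smul_mem hxΩ (t := (μ : ℝ)⁻¹) (by positivity) (inv_le_one_of_one_le₀ hμ1.le)
        rwa [inv_smul_smul₀ hμ0.ne'] at this
      · rwa [mem_preimage, mul_smul])
  set T := S \ ((μ : ℝ) • ·) ⁻¹' S with hT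
  have hTm : MeasurableSet T := hSo.measurableSet.diff (measurable_const_smul _ hSo.measurableSet)
  have hTfin : volume T ≠ ⊤ := ((measure_mono sdiff_subset).trans_lt hSfin.lt_top).ne
  have hTc : ∀ x ∈ T, c ≤ ∑ i : Fin n, (fderiv ℝ U x (EuclideanSpace.single i 1) -
      fderiv ℝ (dilation n U μ) x (EuclideanSpace.single i 1)) ^ 2 := by
    rintro x ⟨⟨hxΩ, hxC⟩, hxS⟩
    simp only [mem_iUnion] at hxC
    obtain ⟨t, ht, hxt⟩ := hxC
    rw [mem_Ioi] at ht
    have hμx : (μ : ℝ) • x ∉ Ω := fun h => hxS ⟨h, mem_biUnion (x := t / μ) (div_pos ht hμ0) (by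
      rwa [mem_preimage, smul_smul, div_mul_cancel₀ _ hμ0.ne'])⟩
    have hVx : dilation n U μ x = 0 := by
      rw [dilation, NNReal.smul_def, hU.zero _ hμx, mul_zero]
    rw [(isLocalMin_of_nonneg_of_eq_zero hV.nonneg hVx).fderiv_eq_zero]
    simp only [zero_apply, sub_zero]
    refine hgrad x ⟨hxΩ, ?_⟩
    obtain ⟨hy1, hy2⟩ := hs hxt
    have ht1 : 1 < t := by
      by_contra! h
      exact hy1 (subset_closure (hstar.smul_mem hxΩ ht.le h))
    have hd : dist (t • x) x = ‖t • x‖ - ‖x‖ := by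
      rw [dist_eq_norm, norm_smul, Real.norm_of_nonneg ht.le]
      nth_rw 2 [← one_smul ℝ x]
      rw [← sub_smul, norm_smul, Real.norm_of_nonneg (by linarith)]
      ring
    have hzx : ‖z‖ ≤ μ * ‖x‖ := by
      by_contra! h
      exact hμx (hz (by rwa [mem_ball_zero_iff, norm_smul, Real.norm_of_nonneg hμ0.le]))
    have hy3 : ‖t • x‖ ≤ ‖z‖ + dist (t • x) z := by
      rw [dist_eq_norm]; exact norm_le_norm_add_norm_sub' _ _
    rw [mem_ball] at hy2 ⊢
    have htri := dist_triangle_left x z (t • x)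
    have hx2 : ‖z‖ - ‖z‖ * (μ - 1) ≤ ‖x‖ := by
      nlinarith [mul_nonneg hz0.le (sq_nonneg ((μ : ℝ) - 1))]
    linarith
  calc c * (volume.real S / 2) * (μ - 1) = c * (volume.real S / 2 * (μ - 1)) := by ring
    _ ≤ c * volume.real T := by gcongr
    _ = ∫ x, T.indicator (fun _ => c) x := by
        rw [integral_indicator_const c hTm, smul_eq_mul, mul_comm]
    _ ≤ _ := by
        refine integral_mono ((integrableOn_const hTfin).integrable_indicator hTm)
          (dirichletForm_sub_sub hΩb hU hV).1 fun x => ?_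
        by_cases hx : x ∈ T
        · rw [indicator_of_mem hx]; exact hTc x hx
        · rw [indicator_of_notMem hx]
          exact Finset.sum_nonneg fun i _ => sq_nonneg _

end

theorem IsOpen.exists_mem_frontier_ball_subset {E : Type*} [NormedAddCommGroup E]
    [NormedSpace ℝ E] [FiniteDimensional ℝ E] [Nontrivial E] {Ω : Set E} (hΩ : IsOpen Ω)
    (hΩb : Bornology.IsBounded Ω) (h0 : (0 : E) ∈ Ω) :
    ∃ z ∈ frontier Ω, 0 < ‖z‖ ∧ ball 0 ‖z‖ ⊆ Ω := by
  have : ProperSpace E := FiniteDimensional.proper ℝ E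
  have hne : Ωᶜ.Nonempty := by
    rw [nonempty_compl]
    rintro rfl
    exact NormedSpace.unbounded_univ ℝ E hΩb
  obtain ⟨z, hz, hzd⟩ := hΩ.isClosed_compl.exists_infDist_eq_dist hne 0
  rw [dist_zero_left] at hzd
  have hz0 : 0 < ‖z‖ := norm_pos_iff.2 fun h => hz (h ▸ h0)
  have hball : ball 0 ‖z‖ ⊆ Ω := fun x hx => by
    by_contra hxn
    have := infDist_le_dist_of_mem (x := (0 : E)) (show x ∈ Ωᶜ from hxn)
    rw [hzd, dist_zero_left] at this
    rw [mem_ball_zero_iff] at hx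
    linarith
  refine ⟨z, ?_, hz0, hball⟩
  rw [hΩ.frontier_eq]
  refine ⟨closure_mono hball ?_, hz⟩
  rw [closure_ball 0 hz0.ne']
  simp

theorem stmt_14 (n : ℕ) (hn : 3 ≤ n) (α : ℝ) (hα0 : 0 < α) (hαn : α < n)
    (Ω : Set (EuclideanSpace ℝ (Fin n)))
    (hΩopen : IsOpen Ω) (hΩbd : Bornology.IsBounded Ω)
    (hstar : StarConvex ℝ 0 Ω)
    (u : EuclideanSpace ℝ (Fin n) → ℝ)
    (hreg : ContDiffOn ℝ 2 u (closure Ω))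
    (hnonneg : ∀ x ∈ Ω, 0 ≤ u x)
    (hbd : ∀ x ∈ frontier Ω, u x = 0)
    (heq : ∀ x ∈ Ω, -(lap n u x) =
      (∫ y in Ω, u y ^ ((2 * (n : ℝ) - α) / ((n : ℝ) - 2)) / ‖x - y‖ ^ α) *
        u x ^ ((2 * (n : ℝ) - α) / ((n : ℝ) - 2) - 1)) :
    ∀ x ∈ Ω, u x = 0 := by
  have : Nonempty (Fin n) := ⟨⟨0, by omega⟩⟩
  by_contra! hcon
  obtain ⟨x₀, hx₀, hux₀⟩ := hcon
  have h0 : (0 : EuclideanSpace ℝ (Fin n)) ∈ Ω := by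
    simpa using hstar.smul_mem hx₀ le_rfl zero_le_one
  have hcont : ContinuousOn u (closure Ω) := hreg.continuousOn
  have hC2 : ∀ x ∈ Ω, ContDiffAt ℝ 2 u x := fun x hx =>
    (hreg x (subset_closure hx)).contDiffAt
      (mem_of_superset (hΩopen.mem_nhds hx) subset_closure)
  have hcl : IsCompact (closure Ω) := hΩbd.isCompact_closure
  have hu0 : ∀ x ∈ closure Ω, 0 ≤ u x := fun x hx => by
    by_cases hxΩ : x ∈ Ω
    · exact hnonneg x hxΩ
    · exact (hbd x (by rw [hΩopen.frontier_eq]; exact ⟨hx, hxΩ⟩)).ge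
  have hlap : ∀ x ∈ Ω, lap n u x ≤ 0 := fun x hx => by
    have : 0 ≤ -lap n u x := by
      rw [heq x hx]
      refine mul_nonneg (setIntegral_nonneg hΩopen.measurableSet fun y hy => ?_)
        (Real.rpow_nonneg (hnonneg x hx) _)
      exact div_nonneg (Real.rpow_nonneg (hnonneg y hy) _) (Real.rpow_nonneg (norm_nonneg _) _)
    linarith
  have hlim := fun x hx => hreg.exists_tendsto_fderiv_of_mem_closure (x := x) hΩopen hx
  obtain ⟨M, hM0, hM⟩ := hcl.exists_bound_of_tendsto (f := fderiv ℝ u) fun x hx => by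
    obtain ⟨L, -, -, h, -⟩ := hlim x hx
    exact ⟨L, h⟩
  obtain ⟨M₂, hM₂0, hM₂⟩ := hcl.exists_bound_of_tendsto (f := fderiv ℝ (fderiv ℝ u)) fun x hx => by
    obtain ⟨-, M', -, -, h⟩ := hlim x hx
    exact ⟨M', h⟩
  lift M to ℝ≥0 using hM0
  lift M₂ to ℝ≥0 using hM₂0
  obtain ⟨B, hB⟩ := hcl.exists_bound_of_continuousOn hcont
  have hB0 : 0 ≤ B := (norm_nonneg _).trans (hB 0 (subset_closure h0))
  lift B to ℝ≥0 using hB0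
  have hU : IsLipSupportedOn Ω M B (Ω.indicator u) :=
    { lipschitz := lipschitzWith_indicator_of_fderiv_le hΩopen hcont hbd
        (fun x hx => (hC2 x hx).differentiableAt (by norm_num)) hM
      bound := fun x => by
        by_cases hx : x ∈ Ω
        · simpa [hx] using hB x (subset_closure hx)
        · simp [hx]
      nonneg := fun x => indicator_nonneg hnonneg x
      zero := fun x hx => indicator_of_notMem hx u }
  obtain ⟨z, hzf, hz0, hzball⟩ := hΩopen.exists_mem_frontier_ball_subset hΩbd h0
  have hzcl : z ∈ closure Ω := frontier_subset_closure hzf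
  obtain ⟨L, -, hL, hLt, -⟩ := hlim z hzcl
  have hL0 : L = 0 := by
    by_cases hzi : z ∈ interior (closure Ω)
    · have hmem : closure Ω ∈ 𝓝 z := mem_interior_iff_mem_nhds.1 hzi
      refine IsLocalMin.hasFDerivAt_eq_zero ?_ (hL.hasFDerivAt hmem)
      filter_upwards [hmem] with y hy
      rw [hbd z hzf]
      exact hu0 y hy
    · by_contra hLne
      have hex : ∃ i : Fin n, L (EuclideanSpace.single i 1) ≠ 0 := by
        by_contra! h
        refine hLne (ContinuousLinearMap.coe_injective
          ((EuclideanSpace.basisFun (Fin n) ℝ).toBasis.ext fun i => ?_))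
        simpa using h i
      obtain ⟨i, hi⟩ := hex
      set q := ∑ i : Fin n, L (EuclideanSpace.single i 1) ^ 2 with hq
      have hq0 : 0 < q :=
        Finset.sum_pos' (fun i _ => sq_nonneg _) ⟨i, Finset.mem_univ i, by positivity⟩
      have hqt : Tendsto (fun x => ∑ i : Fin n, fderiv ℝ u x (EuclideanSpace.single i 1) ^ 2)
          (𝓝[Ω] z) (𝓝 q) :=
        tendsto_finsetSum _ fun i _ => (((ContinuousLinearMap.apply ℝ ℝ
          (EuclideanSpace.single i (1 : ℝ))).continuous.tendsto L).comp hLt).pow 2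
      obtain ⟨ρ, hρ, hball⟩ := Metric.mem_nhdsWithin_iff.1
        (hqt.eventually (lt_mem_nhds (half_lt_self hq0)))
      obtain ⟨c', hc'0, hc'⟩ := hU.exists_le_dirichlet_sub_dilation hΩopen hΩbd hstar hz0 hzball
        hzi (half_pos hq0) hρ fun x hx => by
          simp only [fderiv_indicator_of_mem hΩopen u hx.1]
          exact (hball ⟨hx.2, hx.1⟩).le
      have hup := eventually_dirichlet_sub_dilation_le hn hΩopen hΩbd hstar hαn hC2 hnonneg hM hM₂
        hU heq (half_pos hc'0)
      obtain ⟨μ, ⟨h1, h2⟩, hμ⟩ := ((hc'.and hup).and self_mem_nhdsWithin).exists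
      have hμ1 : (1 : ℝ) < μ := by exact_mod_cast hμ
      nlinarith
  subst hL0
  have hpos := (hstar.isPathConnected h0).isConnected.isPreconnected.forall_pos_of_lap_nonpos
    (by omega) hΩopen hcont hC2 hlap hu0 hx₀ ((hnonneg x₀ hx₀).lt_of_ne' hux₀)
  exact not_hasFDerivWithinAt_zero_of_lap_nonpos (by omega) hcont hC2 hlap hu0 hz0 hzball
    (fun x hx => hpos x (hzball hx)) (dist_zero_right z) (hbd z hzf) hL
end
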